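/- There is a computable age 𝕂, which is the canonical computable age of some computable structure in a finite relational language, such that 𝕂 has coAP but for every Turing degree s, if 𝕂 has CcoAP(s) then 0' ≤_T s. -/

import Mathlib

/- Self-contained framework for computable ages and cofinal Fraïssé limits. -/

namespace CFL

open Classical

/-! ### Oracle computability -/

/-- The characteristic partial function of a set of naturals. -/
noncomputable def chi (A : Set ℕ) : ℕ →. ℕ :=
  fun n => Part.some (if n ∈ A then 1 else 0)

/-- Codes for oracle partial recursive functions. -/
inductive OCode : Type
  | zero : OCode
  | succ : OCode
  | left : OCode
  | right : OCode
  | oracle : OCode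
  | pair : OCode → OCode → OCode
  | comp : OCode → OCode → OCode
  | prec : OCode → OCode → OCode
  | rfind' : OCode → OCode

/-- Evaluation of an oracle code relative to an oracle `O`. -/
def OCode.eval (O : ℕ →. ℕ) : OCode → ℕ →. ℕ
  | OCode.zero => pure 0
  | OCode.succ => Nat.succ
  | OCode.left => ↑fun n : ℕ => n.unpair.1
  | OCode.right => ↑fun n : ℕ => n.unpair.2
  | OCode.oracle => O
  | OCode.pair cf cg => fun n => Nat.pair <$> OCode.eval O cf n <*> OCode.eval O cg n
  | OCode.comp cf cg => fun n => OCode.eval O cg n >>= OCode.eval O cf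
  | OCode.prec cf cg =>
    Nat.unpaired fun a n =>
      n.rec (OCode.eval O cf a) fun y IH => do
        let i ← IH
        OCode.eval O cg (Nat.pair a (Nat.pair y i))
  | OCode.rfind' cf =>
    Nat.unpaired fun a m =>
      (Nat.rfind fun n => (fun m => m = 0) <$> OCode.eval O cf (Nat.pair a (n + m))).map
        (· + m)

/-- A numerical code of an `OCode`. -/
def OCode.encodeCode : OCode → ℕ
  | OCode.zero => 0
  | OCode.succ => 1
  | OCode.left => 2
  | OCode.right => 3
  | OCode.oracle => 4
  | OCode.pair cf cg => 4 * Nat.pair cf.encodeCode cg.encodeCode + 5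
  | OCode.comp cf cg => 4 * Nat.pair cf.encodeCode cg.encodeCode + 6
  | OCode.prec cf cg => 4 * Nat.pair cf.encodeCode cg.encodeCode + 7
  | OCode.rfind' cf => 4 * cf.encodeCode + 8

/-- `f` is a partial function recursive in the oracle set `O`. -/
def RecFunIn (O : Set ℕ) (f : ℕ →. ℕ) : Prop :=
  ∃ c : OCode, OCode.eval (chi O) c = f

/-- The code `c` computes the total function `f` relative to the oracle set `O`. -/
def ComputesIn (O : Set ℕ) (c : OCode) (f : ℕ → ℕ) : Prop :=
  ∀ n, OCode.eval (chi O) c n = Part.some (f n)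

/-- `f` is a total function computable in the oracle set `O`. -/
def TotalComputableIn (O : Set ℕ) (f : ℕ → ℕ) : Prop :=
  ∃ c : OCode, ComputesIn O c f

/-- The set `A` is computable in the oracle set `O`. -/
def SetRecIn (O A : Set ℕ) : Prop := RecFunIn O (chi A)

/-- Turing reducibility (on sets of naturals, regarded as representatives of
Turing degrees). -/
def TuringLE (A B : Set ℕ) : Prop := SetRecIn B A

/-- The set `A` is computably enumerable in the oracle set `O`. -/
def CEIn (O A : Set ℕ) : Prop :=
  ∃ c : OCode, ∀ n, n ∈ A ↔ (OCode.eval (chi O) c n).Dom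

/-- The Turing jump of a set of naturals. -/
def jump (O : Set ℕ) : Set ℕ :=
  { e | ∃ c : OCode, c.encodeCode = (Nat.unpair e).1 ∧
      (OCode.eval (chi O) c (Nat.unpair e).2).Dom }

/-- `0'`, the jump of the least degree. -/
def zeroJump : Set ℕ := jump ∅

/-- `0''`. -/
def zeroJump2 : Set ℕ := jump zeroJump

/-- `0'''`. -/
def zeroJump3 : Set ℕ := jump zeroJump2

/-! ### Languages and structures -/

/-- A (coded) first-order language: `relArity r = some k` means that `r` is the code of a
relation symbol of arity `k`, and similarly for function symbols. -/
structure Lang where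
  relArity : ℕ → Option ℕ
  funArity : ℕ → Option ℕ

/-- The language is computably represented. -/
def Lang.ComputableRep (L : Lang) : Prop :=
  TotalComputableIn ∅ (fun r => Encodable.encode (L.relArity r)) ∧
  TotalComputableIn ∅ (fun f => Encodable.encode (L.funArity f))

/-- A finite relational language. -/
def Lang.FiniteRelational (L : Lang) : Prop :=
  (∀ f, L.funArity f = none) ∧ { r | (L.relArity r).isSome = true }.Finite

/-- A finite language. -/
def Lang.FiniteLang (L : Lang) : Prop :=
  { r | (L.relArity r).isSome = true }.Finite ∧
  { f | (L.funArity f).isSome = true }.Finite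

/-- An `L`-structure with underlying set a set of naturals. -/
structure Str (L : Lang) where
  dom : Set ℕ
  rel : ℕ → List ℕ → Prop
  fn : ℕ → List ℕ → ℕ
  rel_valid : ∀ r as, rel r as → L.relArity r = some as.length ∧ ∀ x ∈ as, x ∈ dom
  fn_mem : ∀ f as, L.funArity f = some as.length → (∀ x ∈ as, x ∈ dom) → fn f as ∈ dom

variable {L : Lang}

/-- The (finite) tuple `as` lies in the structure `A`. -/
def TupleIn (A : Str L) (as : List ℕ) : Prop := ∀ x ∈ as, x ∈ A.dom

/-- Membership in the substructure of `A` generated by the tuple `s`. -/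
inductive InClosure (A : Str L) (s : List ℕ) : ℕ → Prop
  | base {x : ℕ} : x ∈ s → x ∈ A.dom → InClosure A s x
  | fn (f : ℕ) (as : List ℕ) : L.funArity f = some as.length →
      (∀ x ∈ as, InClosure A s x) → InClosure A s (A.fn f as)

theorem InClosure.mem_dom {A : Str L} {s : List ℕ} {x : ℕ}
    (h : InClosure A s x) : x ∈ A.dom := by
  induction h with
  | base _ hx => exact hx
  | fn f as ha _ ih => exact A.fn_mem f as ha ih

/-- The substructure of `A` generated by the tuple `s`. -/
def Str.sub (A : Str L) (s : List ℕ) : Str L where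
  dom := { x | InClosure A s x }
  rel r as := A.rel r as ∧ ∀ x ∈ as, InClosure A s x
  fn := A.fn
  rel_valid := fun r as h => ⟨(A.rel_valid r as h.1).1, h.2⟩
  fn_mem := fun f as ha hm => InClosure.fn f as ha hm

/-- `h` is an embedding of `A` into `B`. -/
def IsEmbMap (A B : Str L) (h : ℕ → ℕ) : Prop :=
  (∀ x ∈ A.dom, h x ∈ B.dom) ∧
  (∀ x ∈ A.dom, ∀ y ∈ A.dom, h x = h y → x = y) ∧
  (∀ r as, TupleIn A as → (A.rel r as ↔ B.rel r (as.map h))) ∧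
  (∀ f as, L.funArity f = some as.length → TupleIn A as →
    h (A.fn f as) = B.fn f (as.map h))

/-- `A` embeds into `B`. -/
def Embeds (A B : Str L) : Prop := ∃ h, IsEmbMap A B h

/-- `h` is an isomorphism of `A` onto `B`. -/
def IsIsoMap (A B : Str L) (h : ℕ → ℕ) : Prop :=
  IsEmbMap A B h ∧ ∀ y ∈ B.dom, ∃ x ∈ A.dom, h x = y

/-- `A` and `B` are isomorphic. -/
def Isom (A B : Str L) : Prop := ∃ h, IsIsoMap A B h

/-- `as ∼cl bs`: the coordinatewise map extends to an isomorphism of generated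
substructures. -/
def ClSim (A : Str L) (as : List ℕ) (B : Str L) (bs : List ℕ) : Prop :=
  ∃ h : ℕ → ℕ, as.map h = bs ∧ IsIsoMap (A.sub as) (B.sub bs) h

/-- `as ∼tuple bs`: equal length and the same pattern of equalities among coordinates. -/
def TupleSim (as bs : List ℕ) : Prop :=
  ∃ h h' : ℕ → ℕ, as.map h = bs ∧ bs.map h' = as

/-- `A` is finitely generated. -/
def Str.FG (A : Str L) : Prop :=
  ∃ s : List ℕ, TupleIn A s ∧ ∀ x, x ∈ A.dom ↔ InClosure A s x

/-- `g` is an automorphism of `M`. -/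
def IsAutoOf (M : Str L) (g : ℕ → ℕ) : Prop := IsIsoMap M M g

/-! ### Ages (as isomorphism-closed classes) -/

/-- `B` belongs to the age of `M`, i.e. `B` is isomorphic to a finitely generated
substructure of `M`. -/
def AgeMemOf (M : Str L) (B : Str L) : Prop :=
  ∃ as : List ℕ, TupleIn M as ∧ Isom B (M.sub as)

/-- The age of a structure `M`. -/
def ageOf (M : Str L) : Set (Str L) := { B | AgeMemOf M B }

/-- The hereditary property. -/
def HP (C : Set (Str L)) : Prop :=
  ∀ B ∈ C, ∀ as : List ℕ, TupleIn B as → B.sub as ∈ C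

/-- The joint embedding property. -/
def JEP (C : Set (Str L)) : Prop :=
  ∀ A ∈ C, ∀ B ∈ C, ∃ D ∈ C, Embeds A D ∧ Embeds B D

/-- Every pair of embeddings with domain `A` into members of `C` can be amalgamated
over `A` inside `C`. -/
def AmalgamatesOver (C : Set (Str L)) (A : Str L) : Prop :=
  ∀ B₀ ∈ C, ∀ B₁ ∈ C, ∀ f₀ f₁ : ℕ → ℕ, IsEmbMap A B₀ f₀ → IsEmbMap A B₁ f₁ →
    ∃ D ∈ C, ∃ g₀ g₁ : ℕ → ℕ, IsEmbMap B₀ D g₀ ∧ IsEmbMap B₁ D g₁ ∧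
      ∀ x ∈ A.dom, g₀ (f₀ x) = g₁ (f₁ x)

/-- The amalgamation property. -/
def AP (C : Set (Str L)) : Prop := ∀ A ∈ C, AmalgamatesOver C A

/-- `A` is an amalgamation base of the class `C`. -/
def AmalgBase (C : Set (Str L)) (A : Str L) : Prop := A ∈ C ∧ AmalgamatesOver C A

/-- The cofinal amalgamation property. -/
def CoAP (C : Set (Str L)) : Prop :=
  ∀ A ∈ C, ∃ A' : Str L, AmalgBase C A' ∧ Embeds A A'

/-! ### Computable ages -/

/-- An (abstract) enumerated age: for each index `i`, a generating tuple `tup i` and the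
structure `str i` it generates. -/
structure CompAge (L : Lang) where
  tup : ℕ → List ℕ
  str : ℕ → Str L
  tup_mem : ∀ i, TupleIn (str i) (tup i)
  gen : ∀ i x, x ∈ (str i).dom ↔ InClosure (str i) (tup i) x

/-- The class of structures represented by the enumerated age `K`. -/
def CompAge.cls (K : CompAge L) : Set (Str L) := { B | ∃ i, Isom B (K.str i) }

/-- The structure `M` is computable in the oracle set `s`. -/
def StrComputableIn (s : Set ℕ) (M : Str L) : Prop :=
  SetRecIn s M.dom ∧
  SetRecIn s { p | ∃ r as, TupleIn M as ∧ M.rel r as ∧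
      p = Nat.pair r (Encodable.encode as) } ∧
  SetRecIn s { p | ∃ f as b, L.funArity f = some as.length ∧ TupleIn M as ∧
      M.fn f as = b ∧ p = Nat.pair f (Nat.pair (Encodable.encode as) b) }

/-- The coded diagram of an enumerated age. -/
def CompAge.diag (K : CompAge L) : Set ℕ :=
  { p | ∃ i, p = Nat.pair 0 (Nat.pair i (Encodable.encode (K.tup i))) } ∪
  { p | ∃ i x, x ∈ (K.str i).dom ∧ p = Nat.pair 1 (Nat.pair i x) } ∪
  { p | ∃ i r as, TupleIn (K.str i) as ∧ (K.str i).rel r as ∧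
      p = Nat.pair 2 (Nat.pair i (Nat.pair r (Encodable.encode as))) } ∪
  { p | ∃ i r as, TupleIn (K.str i) as ∧ L.relArity r = some as.length ∧
      ¬ (K.str i).rel r as ∧
      p = Nat.pair 3 (Nat.pair i (Nat.pair r (Encodable.encode as))) } ∪
  { p | ∃ i f as b, TupleIn (K.str i) as ∧ L.funArity f = some as.length ∧
      (K.str i).fn f as = b ∧
      p = Nat.pair 4 (Nat.pair i (Nat.pair f (Nat.pair (Encodable.encode as) b))) }

/-- `K` is an `s`-computable age: its diagram is c.e. in `s` and each of its structures
is computable in `s`. -/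
def AgeComputableIn (s : Set ℕ) (K : CompAge L) : Prop :=
  CEIn s K.diag ∧ ∀ i, StrComputableIn s (K.str i)

/-- The embedding information of an enumerated age, as a set of naturals. -/
def EmbedInfo (K : CompAge L) : Set ℕ :=
  { p | ∃ k₀ b₀ k₁ b₁, TupleIn (K.str k₀) b₀ ∧ TupleIn (K.str k₁) b₁ ∧
      ClSim (K.str k₀) b₀ (K.str k₁) b₁ ∧
      p = Nat.pair k₀ (Nat.pair (Encodable.encode b₀)
            (Nat.pair k₁ (Encodable.encode b₁))) }

/-! ### Potential embeddings, spans, and amalgamation diagrams -/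

/-- A potential embedding: a pair of indices and a tuple in the codomain structure. -/
structure PotEmb where
  i : ℕ
  j : ℕ
  c : List ℕ

/-- A numerical code of a potential embedding. -/
def PotEmb.code (F : PotEmb) : ℕ :=
  Nat.pair F.i (Nat.pair F.j (Encodable.encode F.c))

/-- The potential embedding is well-formed with respect to `K`. -/
def PotEmb.Valid (K : CompAge L) (F : PotEmb) : Prop :=
  F.c.length = (K.tup F.i).length ∧ TupleIn (K.str F.j) F.c

/-- The potential embedding is an embedding. -/
def PotEmb.IsEmb (K : CompAge L) (F : PotEmb) : Prop :=
  ClSim (K.str F.i) (K.tup F.i) (K.str F.j) F.c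

/-- The potential embedding is an isomorphism (its range generates the codomain). -/
def PotEmb.IsIso (K : CompAge L) (F : PotEmb) : Prop :=
  F.IsEmb K ∧ ∀ x ∈ (K.str F.j).dom, InClosure (K.str F.j) F.c x

/-- `h` realizes the potential embedding `F` as a map on the domain structure. -/
def ExtMap (K : CompAge L) (F : PotEmb) (h : ℕ → ℕ) : Prop :=
  (K.tup F.i).map h = F.c ∧ IsEmbMap (K.str F.i) (K.str F.j) h

/-- `(F₀, F₁)` is a potential span. -/
def PotSpan (K : CompAge L) (F₀ F₁ : PotEmb) : Prop :=
  F₀.Valid K ∧ F₁.Valid K ∧ F₀.i = F₁.i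

/-- `(G₀, G₁)` is an amalgamation diagram over the potential span `(F₀, F₁)`. -/
def AmalgDiagOver (K : CompAge L) (F₀ F₁ G₀ G₁ : PotEmb) : Prop :=
  G₀.Valid K ∧ G₁.Valid K ∧ G₀.IsEmb K ∧
  G₀.i = F₀.j ∧ G₁.i = F₁.j ∧ G₀.j = G₁.j ∧
  (F₀.IsEmb K → F₁.IsEmb K → G₁.IsEmb K ∧
    ∀ h₀ h₁ : ℕ → ℕ, ExtMap K G₀ h₀ → ExtMap K G₁ h₁ →
      F₀.c.map h₀ = F₁.c.map h₁)

/-- `H` is the composition `F ∘ G` of potential embeddings (where `F` is an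
embedding realized by any `h` extending it). -/
def CompRel (K : CompAge L) (F G H : PotEmb) : Prop :=
  G.j = F.i ∧ H.i = G.i ∧ H.j = F.j ∧
  ∀ h : ℕ → ℕ, ExtMap K F h → H.c = G.c.map h

/-! ### Computable versions of HP, JEP, AP, coAP -/

/-- The `s`-computable hereditary property. -/
def CHP (s : Set ℕ) (K : CompAge L) : Prop :=
  ∃ c : OCode, ∀ i (b : List ℕ), TupleIn (K.str i) b →
    ∃ j, OCode.eval (chi s) c (Nat.pair i (Encodable.encode b)) = Part.some j ∧
      ClSim (K.str j) (K.tup j) (K.str i) b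

/-- The `s`-computable joint embedding property. -/
def CJEP (s : Set ℕ) (K : CompAge L) : Prop :=
  ∃ c : OCode, ∀ i j : ℕ, ∃ F G : PotEmb,
    OCode.eval (chi s) c (Nat.pair i j) = Part.some (Nat.pair F.code G.code) ∧
    F.Valid K ∧ G.Valid K ∧ F.IsEmb K ∧ G.IsEmb K ∧
    F.i = i ∧ G.i = j ∧ F.j = G.j

/-- The `s`-computable amalgamation property. -/
def CAP (s : Set ℕ) (K : CompAge L) : Prop :=
  ∃ c : OCode, ∀ F₀ F₁ : PotEmb, PotSpan K F₀ F₁ →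
    ∃ G₀ G₁ : PotEmb,
      OCode.eval (chi s) c (Nat.pair F₀.code F₁.code) =
        Part.some (Nat.pair G₀.code G₁.code) ∧
      AmalgDiagOver K F₀ F₁ G₀ G₁

/-- A family `W` of distinguished embeddings with amalgamation-base codomains, closed
under pre/post composition with isomorphisms, covering all domains. -/
def IsCoAPFamily (K : CompAge L) (W : Set PotEmb) : Prop :=
  (∀ F ∈ W, F.Valid K ∧ F.IsEmb K ∧ AmalgBase K.cls (K.str F.j)) ∧
  (∀ F ∈ W, ∀ G H : PotEmb, G.Valid K → G.IsIso K → G.j = F.i →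
      CompRel K F G H → H ∈ W) ∧
  (∀ F ∈ W, ∀ G H : PotEmb, G.Valid K → G.IsIso K → G.i = F.j →
      CompRel K G F H → H ∈ W) ∧
  (∀ i : ℕ, ∃ F ∈ W, F.i = i)

/-- The `s`-computable cofinal amalgamation property: there is an `s`-c.e. family of
distinguished embeddings onto amalgamation bases together with an `s`-computable
amalgamation function. -/
def CcoAP (s : Set ℕ) (K : CompAge L) : Prop :=
  ∃ W : Set PotEmb, IsCoAPFamily K W ∧
    CEIn s { p | ∃ F ∈ W, p = F.code } ∧
    ∃ c : OCode, ∀ F ∈ W, ∀ G₀ G₁ : PotEmb,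
      G₀.Valid K → G₁.Valid K → G₀.i = F.j → G₁.i = F.j →
      ∃ D₀ D₁ : PotEmb,
        OCode.eval (chi s) c (Nat.pair F.code (Nat.pair G₀.code G₁.code)) =
          Part.some (Nat.pair D₀.code D₁.code) ∧
        AmalgDiagOver K G₀ G₁ D₀ D₁

/-! ### Ultrahomogeneity -/

/-- `M` is ultrahomogeneous: every isomorphism between finitely generated substructures
extends to an automorphism. -/
def Ultrahomogeneous (M : Str L) : Prop :=
  ∀ as bs : List ℕ, TupleIn M as → TupleIn M bs → ClSim M as M bs →
    ∃ g : ℕ → ℕ, IsAutoOf M g ∧ as.map g = bs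

/-- `g` is a bijection of the underlying set of `M` with itself. -/
def BijOnDom (M : Str L) (g : ℕ → ℕ) : Prop :=
  (∀ x ∈ M.dom, g x ∈ M.dom) ∧
  (∀ x ∈ M.dom, ∀ y ∈ M.dom, g x = g y → x = y) ∧
  (∀ y ∈ M.dom, ∃ x ∈ M.dom, g x = y)

/-- `M` is `s`-computably ultrahomogeneous. -/
def CompUltrahom (s : Set ℕ) (M : Str L) : Prop :=
  ∃ c : OCode, ∀ as bs : List ℕ, TupleIn M as → TupleIn M bs →
    as.length = bs.length →
    ∃ e : ℕ,
      OCode.eval (chi s) c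
          (Nat.pair (Encodable.encode as) (Encodable.encode bs)) = Part.some e ∧
      ∃ c' : OCode, c'.encodeCode = e ∧ ∃ g : ℕ → ℕ, ComputesIn s c' g ∧
        BijOnDom M g ∧
        (ClSim M as M bs → IsAutoOf M g ∧ as.map g = bs)

/-! ### Cofinal ultrahomogeneity -/

/-- `M` is cofinally ultrahomogeneous. -/
def CofinallyUltrahomogeneous (M : Str L) : Prop :=
  ∀ as : List ℕ, TupleIn M as → ∃ bs : List ℕ, TupleIn M bs ∧
    (∀ x ∈ as, InClosure M bs x) ∧
    ∀ cs : List ℕ, TupleIn M cs → ClSim M bs M cs →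
      ∃ g : ℕ → ℕ, IsAutoOf M g ∧ bs.map g = cs

/-- `E` is a cofinal collection of tuples in `M`. -/
def IsCofinalCollection (M : Str L) (E : Set (List ℕ)) : Prop :=
  (∀ bs ∈ E, TupleIn M bs) ∧
  (∀ as : List ℕ, TupleIn M as → ∃ bs ∈ E, ∀ x ∈ as, InClosure M bs x) ∧
  (∀ bs ∈ E, ∀ as : List ℕ, (∀ x ∈ as, InClosure M bs x) → (as ++ bs) ∈ E) ∧
  (∀ as ∈ E, ∀ bs : List ℕ, TupleIn M bs → ClSim M as M bs → bs ∈ E)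

/-- `M` is cofinally ultrahomogeneous for the collection `E`: every isomorphism between
substructures generated by members of `E` extends to an automorphism. -/
def CofUltraFor (M : Str L) (E : Set (List ℕ)) : Prop :=
  ∀ as ∈ E, ∀ bs ∈ E, ClSim M as M bs →
    ∃ g : ℕ → ℕ, IsAutoOf M g ∧ as.map g = bs

/-- The set of codes of members of `E`. -/
def ECodes (E : Set (List ℕ)) : Set ℕ := { p | ∃ as ∈ E, p = Encodable.encode as }

/-- The functional part of `s`-computable cofinal ultrahomogeneity with respect to `E`. -/
def CofUltraFunIn (s : Set ℕ) (M : Str L) (E : Set (List ℕ)) : Prop :=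
  ∃ c : OCode, ∀ as ∈ E, ∀ bs : List ℕ, TupleIn M bs → TupleSim as bs →
    ∃ e : ℕ,
      OCode.eval (chi s) c
          (Nat.pair (Encodable.encode as) (Encodable.encode bs)) = Part.some e ∧
      ∃ c' : OCode, c'.encodeCode = e ∧ ∃ g : ℕ → ℕ, ComputesIn s c' g ∧
        BijOnDom M g ∧ as.map g = bs ∧
        (ClSim M as M bs → IsAutoOf M g)

/-- `M` is `s`-computably cofinally ultrahomogeneous with respect to `E`. -/
def CompCofUltrahomWrt (s : Set ℕ) (M : Str L) (E : Set (List ℕ)) : Prop :=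
  IsCofinalCollection M E ∧ SetRecIn s (ECodes E) ∧ CofUltraFunIn s M E

/-- `M` is `s`-computably cofinally ultrahomogeneous. -/
def CompCofUltrahom (s : Set ℕ) (M : Str L) : Prop :=
  ∃ E : Set (List ℕ), CompCofUltrahomWrt s M E

/-- The `s`-computable cofinal extension property with respect to `E`. -/
def CompCofExtProp (s : Set ℕ) (M : Str L) (E : Set (List ℕ)) : Prop :=
  ∃ c : OCode, ∀ as bs cs : List ℕ, as ∈ E → cs ∈ E → TupleIn M bs →
    (∀ x ∈ as, InClosure M cs x) → TupleSim as bs →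
    ∃ ds : List ℕ,
      OCode.eval (chi s) c
          (Nat.pair (Encodable.encode as)
            (Nat.pair (Encodable.encode bs) (Encodable.encode cs))) =
        Part.some (Encodable.encode ds) ∧
      TupleIn M ds ∧ TupleSim (as ++ cs) (bs ++ ds) ∧
      (ClSim M as M bs →
        ClSim M ds M cs ∧ (∀ x ∈ bs, InClosure M ds x) ∧
        ∀ h h' : ℕ → ℕ,
          ds.map h = cs → IsIsoMap (M.sub ds) (M.sub cs) h →
          bs.map h' = as → IsIsoMap (M.sub bs) (M.sub as) h' →
          bs.map h = bs.map h')

/-! ### Canonical ages and limits -/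

/-- `K` is a canonical age of `M` (relative to the oracle `t`): the enumeration of
generating tuples is `t`-computable, lists every finite tuple of `M` infinitely often,
and `str i` is the substructure generated by `tup i`. -/
def IsCanonicalAgeOf (t : Set ℕ) (K : CompAge L) (M : Str L) : Prop :=
  TotalComputableIn t (fun i => Encodable.encode (K.tup i)) ∧
  (∀ i, TupleIn M (K.tup i)) ∧
  (∀ as : List ℕ, TupleIn M as → ∀ n : ℕ, ∃ i, n ≤ i ∧ K.tup i = as) ∧
  (∀ i, K.str i = M.sub (K.tup i))

/-- `K` represents the age of `M`. -/
def RepresentsAgeOf (K : CompAge L) (M : Str L) : Prop :=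
  (∀ i, AgeMemOf M (K.str i)) ∧
  (∀ B : Str L, AgeMemOf M B → ∃ i, Isom B (K.str i))

/-- `M` is a cofinal Fraïssé limit of (the age represented by) `K`. -/
def CofinalFraisseLimitOf (K : CompAge L) (M : Str L) : Prop :=
  CofinallyUltrahomogeneous M ∧ RepresentsAgeOf K M

/-- The enumerated age `K` is uniformly finite. -/
def UniformlyFinite (K : CompAge L) : Prop :=
  L.FiniteLang ∧ ∃ f : ℕ → ℕ, TotalComputableIn ∅ f ∧
    ∀ i, ∀ as : List ℕ, TupleIn (K.str i) as →
      { x | InClosure (K.str i) as x }.Finite ∧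
      { x | InClosure (K.str i) as x }.ncard ≤ f as.length

end CFL

namespace CFL

open Nat.Partrec (Code)
open Denumerable (ofNat)

/-! ### Basic oracle computability -/

/-- An unrelativized code, read as an oracle code that never queries its oracle. -/
def OCode.ofCode : Code → OCode
  | Code.zero => OCode.zero
  | Code.succ => OCode.succ
  | Code.left => OCode.left
  | Code.right => OCode.right
  | Code.pair cf cg => OCode.pair (ofCode cf) (ofCode cg)
  | Code.comp cf cg => OCode.comp (ofCode cf) (ofCode cg)
  | Code.prec cf cg => OCode.prec (ofCode cf) (ofCode cg)
  | Code.rfind' cf => OCode.rfind' (ofCode cf)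

theorem OCode.eval_ofCode (O : ℕ →. ℕ) (c : Code) :
    OCode.eval O (OCode.ofCode c) = Code.eval c := by
  induction c with
  | zero => rfl
  | succ => rfl
  | left => rfl
  | right => rfl
  | pair cf cg hf hg => simp only [OCode.ofCode, OCode.eval, Code.eval, hf, hg]; rfl
  | comp cf cg hf hg => simp only [OCode.ofCode, OCode.eval, Code.eval, hf, hg]; rfl
  | prec cf cg hf hg => simp only [OCode.ofCode, OCode.eval, Code.eval, hf, hg]; rfl
  | rfind' cf hf => simp only [OCode.ofCode, OCode.eval, Code.eval, hf]; rfl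

theorem exists_oCode_of_partrec {f : ℕ →. ℕ} (hf : Partrec f) (O : ℕ →. ℕ) :
    ∃ c : OCode, OCode.eval O c = f := by
  obtain ⟨c, hc⟩ := Code.exists_code.1 (Partrec.nat_iff.1 hf)
  exact ⟨OCode.ofCode c, by rw [OCode.eval_ofCode, hc]⟩

theorem totalComputableIn_of_computable {f : ℕ → ℕ} (hf : Computable f) (O : Set ℕ) :
    TotalComputableIn O f := by
  obtain ⟨c, hc⟩ := exists_oCode_of_partrec hf.partrec (chi O)
  exact ⟨c, fun n => by rw [hc]; rfl⟩

theorem setRecIn_of_totalComputableIn {O A : Set ℕ} {f : ℕ → ℕ} (hf : TotalComputableIn O f)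
    (h1 : ∀ n, n ∈ A → f n = 1) (h0 : ∀ n, n ∉ A → f n = 0) : SetRecIn O A := by
  obtain ⟨c, hc⟩ := hf
  refine ⟨c, funext fun n => ?_⟩
  rw [hc n, chi]
  split_ifs with h
  · rw [h1 n h]
  · rw [h0 n h]

theorem computable_boolToNat {α : Type*} [Primcodable α] {f : α → Bool} (hf : Computable f) :
    Computable fun a => (f a).toNat :=
  (Computable.cond hf (Computable.const 1) (Computable.const 0)).of_eq fun a => by
    cases f a <;> rfl

theorem setRecIn_of_computable {A : Set ℕ} {f : ℕ → Bool} (hf : Computable f)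
    (h : ∀ n, n ∈ A ↔ f n = true) (O : Set ℕ) : SetRecIn O A := by
  refine setRecIn_of_totalComputableIn
    (totalComputableIn_of_computable (computable_boolToNat hf) O) (fun n hn => ?_) fun n hn => ?_
  · simp [(h n).1 hn]
  · rw [h n, Bool.not_eq_true] at hn
    simp [hn]

theorem ceIn_of_computable {A : Set ℕ} {f : ℕ → Bool} (hf : Computable f)
    (h : ∀ n, n ∈ A ↔ f n = true) (O : Set ℕ) : CEIn O A := by
  have hp : Partrec fun n => cond (f n) (Part.some 0) (Part.none : Part ℕ) :=
    Partrec.cond hf (Computable.const 0) Partrec.none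
  obtain ⟨c, hc⟩ := exists_oCode_of_partrec hp (chi O)
  refine ⟨c, fun n => ?_⟩
  rw [hc, h n]
  change _ ↔ (cond (f n) (Part.some 0) (Part.none : Part ℕ)).Dom
  cases f n <;> simp

namespace TotalComputableIn

variable {O : Set ℕ} {f g : ℕ → ℕ}

theorem of_eq (hf : TotalComputableIn O f) (h : ∀ n, f n = g n) : TotalComputableIn O g :=
  funext h ▸ hf

theorem comp (hf : TotalComputableIn O f) (hg : TotalComputableIn O g) :
    TotalComputableIn O fun n => f (g n) := by
  obtain ⟨cf, hf⟩ := hf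
  obtain ⟨cg, hg⟩ := hg
  exact ⟨OCode.comp cf cg, fun n => by
    change (OCode.eval (chi O) cg n).bind (OCode.eval (chi O) cf) = _
    rw [hg n]
    exact (Part.bind_some _ _).trans (hf _)⟩

theorem pair (hf : TotalComputableIn O f) (hg : TotalComputableIn O g) :
    TotalComputableIn O fun n => Nat.pair (f n) (g n) := by
  obtain ⟨cf, hf⟩ := hf
  obtain ⟨cg, hg⟩ := hg
  exact ⟨OCode.pair cf cg, fun n => by simp [OCode.eval, hg n, hf n, Seq.seq]⟩

theorem iterate (a : ℕ) (hg : TotalComputableIn O g) :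
    TotalComputableIn O fun n => Nat.rec a (fun y r => g (Nat.pair y r)) n := by
  obtain ⟨c₀, h₀⟩ := totalComputableIn_of_computable (Computable.const a) O
  obtain ⟨c₁, h₁⟩ := hg.comp (totalComputableIn_of_computable (f := fun p => p.unpair.2)
    (Computable.snd.comp Computable.unpair) O)
  obtain ⟨c₂, h₂⟩ := totalComputableIn_of_computable (f := Nat.pair 0)
    ((Primrec₂.natPair.comp (Primrec.const 0) Primrec.id).to_comp) O
  refine ⟨OCode.comp (OCode.prec c₀ c₁) c₂, fun n => ?_⟩
  simp only [OCode.eval, h₂ n, Part.bind_eq_bind, Part.bind_some, Nat.unpaired, Nat.unpair_pair]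
  induction n with
  | zero => exact h₀ 0
  | succ n ih => simpa [ih] using h₁ (Nat.pair 0 (Nat.pair n (Nat.rec a (fun y r => g (Nat.pair y r)) n)))

/-- Unbounded search for a zero of a total computable function that has one. -/
theorem exists_search (hg : TotalComputableIn O g) (h : ∀ n, ∃ k, g (Nat.pair n k) = 0) :
    ∃ f, TotalComputableIn O f ∧ ∀ n, g (Nat.pair n (f n)) = 0 := by
  obtain ⟨c, hc⟩ := hg
  obtain ⟨c₂, h₂⟩ := totalComputableIn_of_computable (f := fun n => Nat.pair n 0)
    ((Primrec₂.natPair.comp Primrec.id (Primrec.const 0)).to_comp) O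
  classical
  refine ⟨fun n => Nat.find (h n), ⟨OCode.comp (OCode.rfind' c) c₂, fun n => ?_⟩,
    fun n => Nat.find_spec (h n)⟩
  simp only [OCode.eval, h₂ n, Part.bind_eq_bind, Part.bind_some, Nat.unpaired, Nat.unpair_pair,
    add_zero]
  rw [Part.eq_some_iff]
  simp only [Part.map_eq_map, Part.mem_map_iff, exists_eq_right]
  refine Nat.mem_rfind.2 ⟨?_, fun {m} hm => ?_⟩
  · exact (Part.mem_map_iff _).2 ⟨_, Part.eq_some_iff.1 (hc _), by simpa using Nat.find_spec (h n)⟩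
  · exact (Part.mem_map_iff _).2 ⟨_, Part.eq_some_iff.1 (hc _), by simpa using Nat.find_min (h n) hm⟩

end TotalComputableIn

/-! ### Finite oracles and bounded search in relatively c.e. sets -/

/-- The partial oracle given by a finite list of answers. -/
def listOracle (σ : List ℕ) : ℕ →. ℕ := fun n => (σ[n]? : Option ℕ)

theorem OCode.eval_mono {O O' : ℕ →. ℕ} (h : ∀ n m, m ∈ O n → m ∈ O' n) (c : OCode) :
    ∀ n m, m ∈ OCode.eval O c n → m ∈ OCode.eval O' c n := by
  induction c with
  | zero | succ | left | right => exact fun n m h => h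
  | oracle => exact h
  | pair cf cg hf hg =>
    intro n m hm
    simp only [OCode.eval, Seq.seq, Part.map_eq_map, Part.mem_bind_iff,
      Part.mem_map_iff] at hm ⊢
    obtain ⟨_, ⟨a, ha, rfl⟩, b, hb, rfl⟩ := hm
    exact ⟨_, ⟨a, hf _ _ ha, rfl⟩, b, hg _ _ hb, rfl⟩
  | comp cf cg hf hg =>
    intro n m hm
    simp only [OCode.eval] at hm ⊢
    obtain ⟨a, ha, hb⟩ := Part.mem_bind_iff.1 hm
    exact Part.mem_bind_iff.2 ⟨a, hg _ _ ha, hf _ _ hb⟩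
  | prec cf cg hf hg =>
    intro p m hm
    simp only [OCode.eval, Nat.unpaired] at hm ⊢
    generalize p.unpair.2 = n at hm ⊢
    induction n generalizing m with
    | zero => exact hf _ _ hm
    | succ n ih =>
      obtain ⟨a, ha, hb⟩ := Part.mem_bind_iff.1 hm
      exact Part.mem_bind_iff.2 ⟨a, ih _ ha, hg _ _ hb⟩
  | rfind' cf hf =>
    intro p m hm
    simp only [OCode.eval, Nat.unpaired] at hm ⊢
    obtain ⟨k, hk, rfl⟩ := (Part.mem_map_iff _).1 hm
    obtain ⟨h1, h2⟩ := Nat.mem_rfind.1 hk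
    refine (Part.mem_map_iff _).2 ⟨k, Nat.mem_rfind.2 ⟨?_, fun {j} hj => ?_⟩, rfl⟩
    · obtain ⟨a, ha, hb⟩ := (Part.mem_map_iff _).1 h1
      exact (Part.mem_map_iff _).2 ⟨a, hf _ _ ha, hb⟩
    · obtain ⟨a, ha, hb⟩ := (Part.mem_map_iff _).1 (h2 hj)
      exact (Part.mem_map_iff _).2 ⟨a, hf _ _ ha, hb⟩

/-- Use principle: a convergent computation is already convergent along an exhausting
chain of oracles. -/
theorem OCode.eval_cont {O : ℕ →. ℕ} {P : ℕ → ℕ →. ℕ}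
    (hmono : ∀ k l, k ≤ l → ∀ n m, m ∈ P k n → m ∈ P l n)
    (hsup : ∀ n m, m ∈ O n → ∃ k, m ∈ P k n) (c : OCode) :
    ∀ n m, m ∈ OCode.eval O c n → ∃ k, m ∈ OCode.eval (P k) c n := by
  have up : ∀ (c : OCode) {k l n m}, k ≤ l → m ∈ OCode.eval (P k) c n →
      m ∈ OCode.eval (P l) c n := fun c _ _ _ _ hkl => OCode.eval_mono (hmono _ _ hkl) c _ _
  induction c with
  | zero | succ | left | right => exact fun n m h => ⟨0, h⟩
  | oracle => exact hsup
  | pair cf cg hf hg =>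
    intro n m hm
    simp only [OCode.eval, Seq.seq, Part.map_eq_map, Part.mem_bind_iff,
      Part.mem_map_iff] at hm ⊢
    obtain ⟨_, ⟨a, ha, rfl⟩, b, hb, rfl⟩ := hm
    obtain ⟨k, hk⟩ := hf _ _ ha
    obtain ⟨l, hl⟩ := hg _ _ hb
    exact ⟨max k l, _, ⟨a, up _ (le_max_left _ _) hk, rfl⟩, b, up _ (le_max_right _ _) hl, rfl⟩
  | comp cf cg hf hg =>
    intro n m hm
    simp only [OCode.eval] at hm ⊢
    obtain ⟨a, ha, hb⟩ := Part.mem_bind_iff.1 hm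
    obtain ⟨k, hk⟩ := hg _ _ ha
    obtain ⟨l, hl⟩ := hf _ _ hb
    exact ⟨max k l, Part.mem_bind_iff.2
      ⟨a, up _ (le_max_left _ _) hk, up _ (le_max_right _ _) hl⟩⟩
  | prec cf cg hf hg =>
    intro p m hm
    simp only [OCode.eval, Nat.unpaired] at hm ⊢
    suffices H : ∃ k, ∀ l, k ≤ l → m ∈ (Nat.rec (OCode.eval (P l) cf p.unpair.1) (fun y IH => do
        let i ← IH
        OCode.eval (P l) cg (Nat.pair p.unpair.1 (Nat.pair y i))) p.unpair.2 : Part ℕ) from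
      H.imp fun k hk => hk k le_rfl
    generalize p.unpair.2 = n at hm ⊢
    induction n generalizing m with
    | zero =>
      obtain ⟨k, hk⟩ := hf _ _ hm
      exact ⟨k, fun l hl => up _ hl hk⟩
    | succ n ih =>
      obtain ⟨a, ha, hb⟩ := Part.mem_bind_iff.1 hm
      obtain ⟨k, hk⟩ := ih _ ha
      obtain ⟨l, hl⟩ := hg _ _ hb
      exact ⟨max k l, fun j hj => Part.mem_bind_iff.2
        ⟨a, hk _ (le_of_max_le_left hj), up _ (le_of_max_le_right hj) hl⟩⟩
  | rfind' cf hf =>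
    intro p m hm
    simp only [OCode.eval, Nat.unpaired] at hm ⊢
    obtain ⟨k, hk, rfl⟩ := (Part.mem_map_iff _).1 hm
    obtain ⟨h1, h2⟩ := Nat.mem_rfind.1 hk
    have key : ∀ (j : ℕ) (b : Bool), b ∈ ((fun m => decide (m = 0)) <$>
        OCode.eval O cf (Nat.pair p.unpair.1 (j + p.unpair.2)) : Part Bool) →
        ∃ K, ∀ l, K ≤ l → b ∈ ((fun m => decide (m = 0)) <$>
          OCode.eval (P l) cf (Nat.pair p.unpair.1 (j + p.unpair.2)) : Part Bool) := by
      intro j b hb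
      obtain ⟨a, ha, hab⟩ := (Part.mem_map_iff _).1 hb
      obtain ⟨K, hK⟩ := hf _ _ ha
      exact ⟨K, fun l hl => (Part.mem_map_iff _).2 ⟨a, up _ hl hK, hab⟩⟩
    obtain ⟨K, hK⟩ := key _ _ h1
    choose! L hL using fun j (hj : j < k) => key j false (h2 hj)
    refine ⟨max K ((Finset.range k).sup L), (Part.mem_map_iff _).2
      ⟨k, Nat.mem_rfind.2 ⟨hK _ (le_max_left _ _), fun {j} hj => hL j hj _ ?_⟩, rfl⟩⟩
    exact le_max_of_le_right (Finset.le_sup (Finset.mem_range.2 hj))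

theorem OCode.partrec_eval_listOracle (c : OCode) :
    Partrec₂ fun (σ : List ℕ) n => OCode.eval (listOracle σ) c n := by
  have hf1 : Computable fun p : List ℕ × ℕ => p.2.unpair.1 :=
    Computable.fst.comp (Computable.unpair.comp Computable.snd)
  have hf2 : Computable fun p : List ℕ × ℕ => p.2.unpair.2 :=
    Computable.snd.comp (Computable.unpair.comp Computable.snd)
  have natPair : Computable₂ Nat.pair := Primrec₂.natPair.to_comp
  induction c with
  | zero => exact (Computable.const 0).partrec.to₂
  | succ => exact (Computable.succ.comp Computable.snd).partrec.to₂
  | left => exact hf1.partrec.to₂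
  | right => exact hf2.partrec.to₂
  | oracle => exact (Computable.ofOption Computable.list_getElem?).to₂
  | pair cf cg hf hg =>
    refine (Partrec.bind hf (Partrec.map (hg.comp (Computable.fst.comp Computable.fst)
      (Computable.snd.comp Computable.fst)) (g := fun (q : (List ℕ × ℕ) × ℕ) b => Nat.pair q.2 b)
      (natPair.comp (Computable.snd.comp Computable.fst) Computable.snd).to₂).to₂).of_eq ?_
    intro p
    simp [OCode.eval, Seq.seq]
  | comp cf cg hf hg =>
    exact Partrec.bind hg (hf.comp (Computable.fst.comp Computable.fst) Computable.snd).to₂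
  | prec cf cg hf hg =>
    refine (Partrec.nat_rec hf2 (hf.comp Computable.fst hf1)
      (h := fun p q => OCode.eval (listOracle p.1) cg (Nat.pair p.2.unpair.1 (Nat.pair q.1 q.2)))
      (hg.comp (Computable.fst.comp Computable.fst) (natPair.comp (hf1.comp Computable.fst)
        (natPair.comp (Computable.fst.comp Computable.snd)
          (Computable.snd.comp Computable.snd)))).to₂).of_eq fun p => rfl
  | rfind' cf hf =>
    have hadd : Computable₂ fun a b : ℕ => a + b := Primrec.nat_add.to_comp
    have hz : Computable fun m : ℕ => decide (m = 0) :=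
      (Primrec.eq.comp Primrec.id (Primrec.const 0)).decide.to_comp
    have hev : Partrec fun q : (List ℕ × ℕ) × ℕ => OCode.eval (listOracle q.1.1) cf
        (Nat.pair q.1.2.unpair.1 (q.2 + q.1.2.unpair.2)) :=
      hf.comp (Computable.fst.comp Computable.fst) (natPair.comp (hf1.comp Computable.fst)
        (hadd.comp Computable.snd (hf2.comp Computable.fst)))
    have htest : Partrec₂ fun (p : List ℕ × ℕ) n => (OCode.eval (listOracle p.1) cf
        (Nat.pair p.2.unpair.1 (n + p.2.unpair.2))).map fun m => decide (m = 0) :=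
      Partrec.map hev (hz.comp Computable.snd).to₂
    have hout : Computable₂ fun (p : List ℕ × ℕ) k => k + p.2.unpair.2 :=
      hadd.comp Computable.snd (hf2.comp Computable.fst)
    exact Partrec.map (Partrec.rfind htest) hout

/-- The list of the first `k` values of the characteristic function of `s`. -/
noncomputable def initSeg (s : Set ℕ) (k : ℕ) : List ℕ :=
  (List.range k).map (Set.indicator s 1)

theorem mem_listOracle_initSeg {s : Set ℕ} {k n m : ℕ} :
    m ∈ listOracle (initSeg s k) n ↔ n < k ∧ m ∈ chi s n := by
  classical
  by_cases h : n < k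
  · simp [listOracle, initSeg, chi, Set.indicator_apply, h]
  · simp [listOracle, initSeg, h]

theorem dom_eval_iff_initSeg (s : Set ℕ) (c : OCode) (n : ℕ) :
    (OCode.eval (chi s) c n).Dom ↔
      ∃ k, (OCode.eval (listOracle (initSeg s k)) c n).Dom := by
  simp only [Part.dom_iff_mem]
  constructor
  · rintro ⟨m, hm⟩
    obtain ⟨k, hk⟩ := OCode.eval_cont (P := fun k => listOracle (initSeg s k))
      (fun k l hkl n m h => by
        rw [mem_listOracle_initSeg] at h ⊢
        exact ⟨h.1.trans_le hkl, h.2⟩)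
      (fun n m h => ⟨n + 1, mem_listOracle_initSeg.2 ⟨n.lt_succ_self, h⟩⟩) c n m hm
    exact ⟨k, m, hk⟩
  · rintro ⟨k, m, hm⟩
    exact ⟨m, OCode.eval_mono (fun n m h => (mem_listOracle_initSeg.1 h).2) c n m hm⟩

theorem totalComputableIn_initSeg (s : Set ℕ) :
    TotalComputableIn s fun k => Encodable.encode (initSeg s k) := by
  classical
  have hchi : TotalComputableIn s (Set.indicator s 1) :=
    ⟨OCode.oracle, fun n => by simp [OCode.eval, chi, Set.indicator_apply]⟩
  have hstep : Computable fun p : ℕ => Encodable.encode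
      (Denumerable.ofNat (List ℕ) p.unpair.2 ++ [p.unpair.1]) :=
    Computable.encode.comp (Computable.list_concat.comp
      ((Computable.ofNat (List ℕ)).comp (Computable.snd.comp Computable.unpair))
      (Computable.fst.comp Computable.unpair))
  have hfst := totalComputableIn_of_computable (f := fun p => p.unpair.1)
    (Computable.fst.comp Computable.unpair) s
  have hsnd := totalComputableIn_of_computable (f := fun p => p.unpair.2)
    (Computable.snd.comp Computable.unpair) s
  refine (TotalComputableIn.iterate (Encodable.encode ([] : List ℕ))
    ((totalComputableIn_of_computable hstep s).comp ((hchi.comp hfst).pair hsnd))).of_eq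
      fun k => ?_
  induction k with
  | zero => rfl
  | succ k ih =>
    simp only [Nat.unpair_pair] at ih ⊢
    rw [ih, Denumerable.ofNat_encode]
    simp [initSeg, List.range_succ]

theorem computable_evaln_isSome {α : Type*} [Primcodable α] {c : α → Code} {t x : α → ℕ}
    (hc : Computable c) (ht : Computable t) (hx : Computable x) :
    Computable fun a => ((c a).evaln (t a) (x a)).isSome :=
  (Primrec.option_isSome.comp Code.primrec_evaln).to_comp.comp ((ht.pair hc).pair hx)

/-- If every `n` has a witness in the `s`-c.e. set `A`, and any such witness decides
membership of `n` in `Z`, then `Z` is computable in `s`. -/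
theorem setRecIn_of_ceIn_witness {s A Z : Set ℕ} (hA : CEIn s A) {R φ : ℕ → ℕ → Bool}
    (hR : Computable₂ R) (hφ : Computable₂ φ) (hex : ∀ n, ∃ p ∈ A, R n p = true)
    (hdec : ∀ n, ∀ p ∈ A, R n p = true → (n ∈ Z ↔ φ n p = true)) : SetRecIn s Z := by
  obtain ⟨c, hc⟩ := hA
  have hpart : Partrec fun q : ℕ =>
      OCode.eval (listOracle (Denumerable.ofNat (List ℕ) q.unpair.1)) c q.unpair.2 :=
    (OCode.partrec_eval_listOracle c).comp
      ((Computable.ofNat (List ℕ)).comp (Computable.fst.comp Computable.unpair))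
      (Computable.snd.comp Computable.unpair)
  obtain ⟨d, hd⟩ := Code.exists_code.1 (Partrec.nat_iff.1 hpart)
  have hmem : ∀ p, p ∈ A ↔ ∃ k t,
      (d.evaln t (Nat.pair (Encodable.encode (initSeg s k)) p)).isSome = true := by
    intro p
    rw [hc p, dom_eval_iff_initSeg]
    refine exists_congr fun k => ?_
    have := congrFun hd (Nat.pair (Encodable.encode (initSeg s k)) p)
    simp only [Nat.unpair_pair, Denumerable.ofNat_encode] at this
    rw [← this, Part.dom_iff_mem]
    simp only [Code.evaln_complete, Option.isSome_iff_exists, Option.mem_def]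
    exact exists_comm
  -- the search space consists of pairs `(p, (k, t))`
  let g : ℕ → ℕ := fun q =>
    (!(R q.unpair.1.unpair.1 q.unpair.1.unpair.2.unpair.1 &&
      (d.evaln q.unpair.1.unpair.2.unpair.2.unpair.2
        (Nat.pair q.unpair.2 q.unpair.1.unpair.2.unpair.1)).isSome)).toNat
  have hfst : Computable fun p : ℕ => p.unpair.1 := Computable.fst.comp Computable.unpair
  have hsnd : Computable fun p : ℕ => p.unpair.2 := Computable.snd.comp Computable.unpair
  have hg : Computable g := by
    have hp := hfst.comp (hsnd.comp hfst)
    have ht := computable_evaln_isSome (Computable.const d)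
      (hsnd.comp (hsnd.comp (hsnd.comp hfst))) ((Primrec₂.natPair.to_comp).comp hsnd hp)
    exact computable_boolToNat ((Primrec.not.to_comp).comp
      ((Primrec.and.to_comp).comp (hR.comp (hfst.comp hfst) hp) ht))
  have hG : TotalComputableIn s fun q => g (Nat.pair q
      (Encodable.encode (initSeg s q.unpair.2.unpair.2.unpair.1))) :=
    (totalComputableIn_of_computable hg s).comp
      ((totalComputableIn_of_computable Computable.id s).pair
        ((totalComputableIn_initSeg s).comp (totalComputableIn_of_computable
          (hfst.comp (hsnd.comp hsnd)) s)))
  have hg0 : ∀ n p k t σ, g (Nat.pair (Nat.pair n (Nat.pair p (Nat.pair k t))) σ) = 0 ↔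
      R n p = true ∧ (d.evaln t (Nat.pair σ p)).isSome = true := by
    intro n p k t σ
    simp only [g, Nat.unpair_pair]
    cases R n p <;> cases (d.evaln t (Nat.pair σ p)).isSome <;> simp
  obtain ⟨f, hf, hf0⟩ := hG.exists_search (fun n => by
    obtain ⟨p, hp, hr⟩ := hex n
    obtain ⟨k, t, ht⟩ := (hmem p).1 hp
    refine ⟨Nat.pair p (Nat.pair k t), ?_⟩
    simp only [Nat.unpair_pair]
    exact (hg0 _ _ _ _ _).2 ⟨hr, ht⟩)
  have hout : Computable fun q : ℕ => (φ q.unpair.1 q.unpair.2.unpair.1).toNat :=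
    computable_boolToNat (hφ.comp hfst (hfst.comp hsnd))
  have hspec : ∀ n, n ∈ Z ↔ φ n (f n).unpair.1 = true := by
    intro n
    have h := hf0 n
    rw [← Nat.pair_unpair (f n), ← Nat.pair_unpair (f n).unpair.2, hg0] at h
    simp only [Nat.unpair_pair] at h
    exact hdec n _ ((hmem _).2 ⟨_, _, h.2⟩) h.1
  refine setRecIn_of_totalComputableIn ((totalComputableIn_of_computable hout s).comp
    ((totalComputableIn_of_computable Computable.id s).pair hf)) (fun n hn => ?_) fun n hn => ?_
  · simp [(hspec n).1 hn]
  · rw [hspec n, Bool.not_eq_true] at hn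
    simp [hn]

/-! ### The halting problem for oracle codes with empty oracle -/

/-- The unrelativized code equivalent to an oracle code with empty oracle. -/
def OCode.toCode : OCode → Code
  | OCode.zero => Code.zero
  | OCode.succ => Code.succ
  | OCode.left => Code.left
  | OCode.right => Code.right
  | OCode.oracle => Code.zero
  | OCode.pair cf cg => Code.pair (toCode cf) (toCode cg)
  | OCode.comp cf cg => Code.comp (toCode cf) (toCode cg)
  | OCode.prec cf cg => Code.prec (toCode cf) (toCode cg)
  | OCode.rfind' cf => Code.rfind' (toCode cf)

theorem OCode.eval_toCode (c : OCode) : (OCode.toCode c).eval = OCode.eval (chi ∅) c := by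
  induction c with
  | zero => rfl
  | succ => rfl
  | left => rfl
  | right => rfl
  | oracle => funext n; simp [OCode.toCode, OCode.eval, Code.eval, chi]; rfl
  | pair cf cg hf hg => simp only [OCode.toCode, OCode.eval, Code.eval, hf, hg]; rfl
  | comp cf cg hf hg => simp only [OCode.toCode, OCode.eval, Code.eval, hf, hg]; rfl
  | prec cf cg hf hg => simp only [OCode.toCode, OCode.eval, Code.eval, hf, hg]; rfl
  | rfind' cf hf => simp only [OCode.toCode, OCode.eval, Code.eval, hf]; rfl

/-- The step of the course-of-values recursion translating codes of `OCode`s: `l` lists the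
translations of all smaller numbers. -/
def translateStep (l : List Code) : Code :=
  let n := l.length
  let m := (n - 5) / 4
  let r := (n - 5) % 4
  let a := l.getD m.unpair.1 Code.zero
  let b := l.getD m.unpair.2 Code.zero
  if n = 0 then Code.zero else if n = 1 then Code.succ else if n = 2 then Code.left
  else if n = 3 then Code.right else if n = 4 then Code.zero
  else if r = 0 then Code.pair a b else if r = 1 then Code.comp a b
  else if r = 2 then Code.prec a b else Code.rfind' (l.getD m Code.zero)

theorem primrec_translateStep : Primrec translateStep := by
  have hn : Primrec fun l : List Code => l.length := Primrec.list_length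
  have h5 : Primrec fun l : List Code => l.length - 5 := Primrec.nat_sub.comp hn (Primrec.const 5)
  have hm : Primrec fun l : List Code => (l.length - 5) / 4 :=
    Primrec.nat_div.comp h5 (Primrec.const 4)
  have hr : Primrec fun l : List Code => (l.length - 5) % 4 :=
    Primrec.nat_mod.comp h5 (Primrec.const 4)
  have ha := (Primrec.list_getD Code.zero).comp Primrec.id
    (Primrec.fst.comp (Primrec.unpair.comp hm))
  have hb := (Primrec.list_getD Code.zero).comp Primrec.id
    (Primrec.snd.comp (Primrec.unpair.comp hm))
  have hc := (Primrec.list_getD Code.zero).comp Primrec.id hm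
  have eqc : ∀ {f : List Code → ℕ} (_ : Primrec f) (k : ℕ), PrimrecPred fun l => f l = k :=
    fun hf k => Primrec.eq.comp hf (Primrec.const k)
  exact Primrec.ite (eqc hn 0) (Primrec.const _) <| Primrec.ite (eqc hn 1) (Primrec.const _) <|
    Primrec.ite (eqc hn 2) (Primrec.const _) <| Primrec.ite (eqc hn 3) (Primrec.const _) <|
    Primrec.ite (eqc hn 4) (Primrec.const _) <|
    Primrec.ite (eqc hr 0) (Code.primrec₂_pair.comp ha hb) <|
    Primrec.ite (eqc hr 1) (Code.primrec₂_comp.comp ha hb) <|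
    Primrec.ite (eqc hr 2) (Code.primrec₂_prec.comp ha hb) <|
    Code.primrec_rfind'.comp hc

/-- Translations of all numbers below `n`. -/
def translateList : ℕ → List Code
  | 0 => []
  | n + 1 => translateList n ++ [translateStep (translateList n)]

/-- The translation of the code of an `OCode`. -/
def translate (n : ℕ) : Code := translateStep (translateList n)

theorem translateList_eq (n : ℕ) : translateList n = (List.range n).map translate := by
  induction n with
  | zero => rfl
  | succ n ih => rw [translateList, List.range_succ, List.map_append, ← ih]; rfl

theorem translate_eq (n : ℕ) : translate n = translateStep ((List.range n).map translate) := by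
  rw [translate, translateList_eq]

theorem primrec_translate : Primrec translate := by
  have : Primrec₂ fun (_ : Unit) n => translate n :=
    Primrec.nat_strong_rec _ (g := fun _ l => some (translateStep l))
      (Primrec.option_some.comp (primrec_translateStep.comp Primrec.snd))
      (fun _ n => by rw [translate_eq n])
  exact this.comp (Primrec.const ()) Primrec.id

theorem translate_encodeCode (c : OCode) : translate c.encodeCode = OCode.toCode c := by
  have hlt : ∀ a b k, 5 ≤ k → a < 4 * Nat.pair a b + k ∧ b < 4 * Nat.pair a b + k := by
    intro a b k hk
    have h1 := Nat.left_le_pair a b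
    have h2 := Nat.right_le_pair a b
    omega
  induction c with
  | zero | succ | left | right | oracle => rfl
  | pair cf cg hf hg =>
    obtain ⟨ha, hb⟩ := hlt cf.encodeCode cg.encodeCode 5 (by norm_num)
    rw [translate_eq, OCode.encodeCode, OCode.toCode, translateStep]
    simp [hf, hg, ha, hb]
  | comp cf cg hf hg =>
    obtain ⟨ha, hb⟩ := hlt cf.encodeCode cg.encodeCode 6 (by norm_num)
    rw [translate_eq, OCode.encodeCode, OCode.toCode, translateStep]
    have h1 : (4 * Nat.pair cf.encodeCode cg.encodeCode + 1) / 4 =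
      Nat.pair cf.encodeCode cg.encodeCode := by omega
    simp [hf, hg, ha, hb, h1]
  | prec cf cg hf hg =>
    obtain ⟨ha, hb⟩ := hlt cf.encodeCode cg.encodeCode 7 (by norm_num)
    rw [translate_eq, OCode.encodeCode, OCode.toCode, translateStep]
    have h1 : (4 * Nat.pair cf.encodeCode cg.encodeCode + 2) / 4 =
      Nat.pair cf.encodeCode cg.encodeCode := by omega
    simp [hf, hg, ha, hb, h1]
  | rfind' cf hf =>
    rw [translate_eq, OCode.encodeCode, OCode.toCode, translateStep]
    have h1 : (4 * cf.encodeCode + 3) / 4 = cf.encodeCode := by omega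
    have h3 : cf.encodeCode < 4 * cf.encodeCode + 8 := by omega
    simp [hf, h1, h3]

theorem encodeCode_surjective : Function.Surjective OCode.encodeCode := by
  intro n
  induction n using Nat.strong_induction_on with
  | _ n ih =>
    by_cases hn : n < 5
    · interval_cases n
      exacts [⟨.zero, rfl⟩, ⟨.succ, rfl⟩, ⟨.left, rfl⟩, ⟨.right, rfl⟩, ⟨.oracle, rfl⟩]
    · have hm : (n - 5) / 4 < n := by omega
      obtain ⟨a, ha⟩ := ih _ ((Nat.unpair_left_le _).trans_lt hm)
      obtain ⟨b, hb⟩ := ih _ ((Nat.unpair_right_le _).trans_lt hm)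
      obtain ⟨c, hc⟩ := ih _ hm
      have hr : (n - 5) % 4 < 4 := Nat.mod_lt _ (by norm_num)
      generalize hr' : (n - 5) % 4 = r at hr
      interval_cases r
      · exact ⟨.pair a b, by rw [OCode.encodeCode, ha, hb, Nat.pair_unpair]; omega⟩
      · exact ⟨.comp a b, by rw [OCode.encodeCode, ha, hb, Nat.pair_unpair]; omega⟩
      · exact ⟨.prec a b, by rw [OCode.encodeCode, ha, hb, Nat.pair_unpair]; omega⟩
      · exact ⟨.rfind' c, by rw [OCode.encodeCode, hc]; omega⟩

theorem mem_zeroJump_iff (e : ℕ) :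
    e ∈ zeroJump ↔ ((translate e.unpair.1).eval e.unpair.2).Dom := by
  constructor
  · rintro ⟨c, hc, h⟩
    rwa [← hc, translate_encodeCode, OCode.eval_toCode]
  · intro h
    obtain ⟨c, hc⟩ := encodeCode_surjective e.unpair.1
    rw [← hc, translate_encodeCode, OCode.eval_toCode] at h
    exact ⟨c, hc, h⟩

/-- `e ∈ 0'` is first confirmed by a computation of `t + 1` steps. -/
def haltsAt (e t : ℕ) : Bool :=
  ((translate e.unpair.1).evaln (t + 1) e.unpair.2).isSome &&
    !((translate e.unpair.1).evaln t e.unpair.2).isSome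

theorem primrec_haltsAt : Primrec₂ haltsAt := by
  have hc : Primrec fun p : ℕ × ℕ => translate p.1.unpair.1 :=
    primrec_translate.comp (Primrec.fst.comp (Primrec.unpair.comp Primrec.fst))
  have hx : Primrec fun p : ℕ × ℕ => p.1.unpair.2 :=
    Primrec.snd.comp (Primrec.unpair.comp Primrec.fst)
  have key : ∀ {t : ℕ × ℕ → ℕ}, Primrec t → Primrec fun p : ℕ × ℕ =>
      ((translate p.1.unpair.1).evaln (t p) p.1.unpair.2).isSome := fun ht =>
    (Primrec.option_isSome.comp Code.primrec_evaln).comp ((ht.pair hc).pair hx)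
  exact Primrec.and.comp (key (Primrec.succ.comp Primrec.snd))
    (Primrec.not.comp (key Primrec.snd))

theorem evaln_isSome_mono {c : Code} {x k l : ℕ} (h : k ≤ l) (hk : (c.evaln k x).isSome = true) :
    (c.evaln l x).isSome = true := by
  obtain ⟨a, ha⟩ := Option.isSome_iff_exists.1 hk
  exact Option.isSome_iff_exists.2 ⟨a, Code.evaln_mono h ha⟩

theorem haltsAt_unique {e t t' : ℕ} (h : haltsAt e t = true) (h' : haltsAt e t' = true) :
    t = t' := by
  simp only [haltsAt, Bool.and_eq_true, Bool.not_eq_true'] at h h'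
  by_contra hne
  rcases Nat.lt_or_gt_of_ne hne with hlt | hlt
  · simp [evaln_isSome_mono hlt h.1] at h'
  · simp [evaln_isSome_mono hlt h'.1] at h

theorem mem_zeroJump_iff_haltsAt (e : ℕ) : e ∈ zeroJump ↔ ∃ t, haltsAt e t = true := by
  rw [mem_zeroJump_iff, Part.dom_iff_mem]
  simp only [Code.evaln_complete]
  constructor
  · rintro ⟨a, k, hk⟩
    have hex : ∃ k, ((translate e.unpair.1).evaln k e.unpair.2).isSome = true :=
      ⟨k, Option.isSome_iff_exists.2 ⟨a, hk⟩⟩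
    have hpos : Nat.find hex ≠ 0 := fun h0 => by
      have := Nat.find_spec hex
      rw [h0] at this
      simp [Code.evaln] at this
    obtain ⟨t, ht⟩ := Nat.exists_eq_succ_of_ne_zero hpos
    have hmin := Nat.find_min hex (ht ▸ t.lt_succ_self)
    refine ⟨t, ?_⟩
    rw [haltsAt, Bool.and_eq_true, Bool.not_eq_true', ← Bool.not_eq_true]
    have hs := Nat.find_spec hex
    rw [ht] at hs
    exact ⟨hs, hmin⟩
  · rintro ⟨t, ht⟩
    rw [haltsAt, Bool.and_eq_true] at ht
    obtain ⟨a, ha⟩ := Option.isSome_iff_exists.1 ht.1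
    exact ⟨a, t + 1, ha⟩

/-! ### Embeddings -/

section Embeddings

variable {L : Lang} {A B C : Str L}

theorem IsEmbMap.id (A : Str L) : IsEmbMap A A fun x => x :=
  ⟨fun _ h => h, fun _ _ _ _ h => h, fun r as _ => by rw [List.map_id'],
    fun f as _ _ => by rw [List.map_id']⟩

theorem Isom.refl (A : Str L) : Isom A A := ⟨fun x => x, IsEmbMap.id A, fun y hy => ⟨y, hy, rfl⟩⟩

theorem IsEmbMap.tupleIn_map {f : ℕ → ℕ} (hf : IsEmbMap A B f) {as : List ℕ}
    (h : TupleIn A as) : TupleIn B (as.map f) := by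
  intro y hy
  obtain ⟨x, hx, rfl⟩ := List.mem_map.1 hy
  exact hf.1 x (h x hx)

theorem IsEmbMap.comp {f g : ℕ → ℕ} (hg : IsEmbMap B C g) (hf : IsEmbMap A B f) :
    IsEmbMap A C fun x => g (f x) := by
  refine ⟨fun x hx => hg.1 _ (hf.1 x hx), fun x hx y hy h =>
    hf.2.1 x hx y hy (hg.2.1 _ (hf.1 x hx) _ (hf.1 y hy) h), fun r as ha => ?_,
    fun k as hk ha => ?_⟩
  · rw [hf.2.2.1 r as ha, hg.2.2.1 r _ (hf.tupleIn_map ha), List.map_map]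
    rfl
  · change g (f _) = _
    rw [hf.2.2.2 k as hk ha, hg.2.2.2 k _ (by simpa using hk) (hf.tupleIn_map ha), List.map_map]
    rfl

end Embeddings

/-! ### The halting structure -/

/-- Elements are pairs `(n, m)`: `(n, 0)` is the `n`-th element of a rooted path, `(n, 1)` is
attached to it, and so is `(n, t + 2)`, present only if `n` enters `0'` at stage `t`. -/
def inHaltDom (x : ℕ) : Bool :=
  decide (x.unpair.2 < 2) || haltsAt x.unpair.1 (x.unpair.2 - 2)

/-- The three binary relations: the rooted path, attachment to the path, and the edge from
`(n, 1)` to `(n, t + 2)`. -/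
def Edge (r x y : ℕ) : Prop :=
  (r = 0 ∧ x.unpair.2 = 0 ∧ y.unpair.2 = 0 ∧
    (y.unpair.1 = x.unpair.1 + 1 ∨ (x.unpair.1 = 0 ∧ y.unpair.1 = 0))) ∨
  (r = 1 ∧ x.unpair.2 = 0 ∧ 1 ≤ y.unpair.2 ∧ x.unpair.1 = y.unpair.1) ∨
  (r = 2 ∧ x.unpair.2 = 1 ∧ 2 ≤ y.unpair.2 ∧ x.unpair.1 = y.unpair.1)

/-- The language with three binary relation symbols. -/
def haltLang : Lang where
  relArity r := if r < 3 then some 2 else none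
  funArity _ := none

/-- The halting structure. -/
def haltStr : Str haltLang where
  dom := { x | inHaltDom x = true }
  rel r as := (∀ x ∈ as, inHaltDom x = true) ∧
    as.length = 2 ∧ Edge r (as.getD 0 0) (as.getD 1 0)
  fn _ _ := 0
  rel_valid := by
    rintro r as ⟨hd, hl, he⟩
    refine ⟨?_, hd⟩
    have : r < 3 := by unfold Edge at he; omega
    simp [haltLang, this, hl]
  fn_mem f as h := by simp [haltLang] at h

theorem haltStr_rel_pair {r x y : ℕ} (hx : x ∈ haltStr.dom) (hy : y ∈ haltStr.dom) :
    haltStr.rel r [x, y] ↔ Edge r x y := by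
  have hx : inHaltDom x = true := hx
  have hy : inHaltDom y = true := hy
  simp [haltStr, hx, hy]

theorem inClosure_haltStr {s : List ℕ} {x : ℕ} :
    InClosure haltStr s x ↔ x ∈ s ∧ x ∈ haltStr.dom := by
  constructor
  · rintro (⟨h, h'⟩ | ⟨f, as, h, -⟩)
    · exact ⟨h, h'⟩
    · simp [haltLang] at h
  · exact fun h => .base h.1 h.2

theorem isEmbMap_sub_iff {s s' : List ℕ} {e : ℕ → ℕ} (hs : TupleIn haltStr s)
    (hs' : TupleIn haltStr s') :
    IsEmbMap (haltStr.sub s) (haltStr.sub s') e ↔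
      (∀ x ∈ s, e x ∈ s') ∧ (∀ x ∈ s, ∀ y ∈ s, e x = e y → x = y) ∧
      ∀ r, ∀ x ∈ s, ∀ y ∈ s, Edge r x y ↔ Edge r (e x) (e y) := by
  have hdom : ∀ {s}, TupleIn haltStr s → ∀ x, x ∈ (haltStr.sub s).dom ↔ x ∈ s :=
    fun hs x => inClosure_haltStr.trans ⟨fun h => h.1, fun h => ⟨h, hs x h⟩⟩
  have hrel : ∀ {s}, TupleIn haltStr s → ∀ r, ∀ x ∈ s, ∀ y ∈ s,
      ((haltStr.sub s).rel r [x, y] ↔ Edge r x y) := by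
    intro s hs r x hx y hy
    rw [← haltStr_rel_pair (hs x hx) (hs y hy)]
    refine ⟨fun h => h.1, fun h => ⟨h, fun z hz => (hdom hs z).2 ?_⟩⟩
    rcases List.mem_pair.1 hz with rfl | rfl <;> assumption
  constructor
  · rintro ⟨h1, h2, h3, -⟩
    simp only [hdom hs, hdom hs'] at h1 h2
    refine ⟨h1, h2, fun r x hx y hy => ?_⟩
    rw [← hrel hs r x hx y hy, ← hrel hs' r _ (h1 x hx) _ (h1 y hy)]
    refine h3 r [x, y] fun z hz => (hdom hs z).2 ?_
    rcases List.mem_pair.1 hz with rfl | rfl <;> assumption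
  · rintro ⟨h1, h2, h3⟩
    refine ⟨?_, ?_, fun r as ha => ?_, fun f as hf => by simp [haltLang] at hf⟩
    · simpa only [hdom hs, hdom hs'] using h1
    · simpa only [hdom hs] using h2
    · by_cases hl : as.length = 2
      · obtain ⟨x, y, rfl⟩ := List.length_eq_two.1 hl
        have hx := (hdom hs x).1 (ha x (by simp))
        have hy := (hdom hs y).1 (ha y (by simp))
        rw [hrel hs r x hx y hy, h3 r x hx y hy]
        exact (hrel hs' r _ (h1 x hx) _ (h1 y hy)).symm
      · exact iff_of_false (fun h => hl h.1.2.1) fun h => hl (by simpa using h.1.2.1)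

theorem mem_dom_of_lt_two {n m : ℕ} (h : m < 2) : Nat.pair n m ∈ haltStr.dom := by
  change inHaltDom _ = true
  simp [inHaltDom, h]

theorem mem_dom_iff_haltsAt {x : ℕ} (h : 2 ≤ x.unpair.2) :
    x ∈ haltStr.dom ↔ haltsAt x.unpair.1 (x.unpair.2 - 2) = true := by
  have h' : ¬ x.unpair.2 < 2 := h.not_gt
  change inHaltDom _ = true ↔ _
  simp only [inHaltDom, h', decide_false, Bool.false_or]

theorem eq_of_unpair_eq {x y : ℕ} (h1 : x.unpair.1 = y.unpair.1)
    (h2 : x.unpair.2 = y.unpair.2) : x = y := by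
  rw [← Nat.pair_unpair x, ← Nat.pair_unpair y, h1, h2]

theorem eq_of_two_le {x y : ℕ} (hx : x ∈ haltStr.dom) (hy : y ∈ haltStr.dom)
    (h2x : 2 ≤ x.unpair.2) (h2y : 2 ≤ y.unpair.2) (h : x.unpair.1 = y.unpair.1) : x = y := by
  rw [mem_dom_iff_haltsAt h2x] at hx
  rw [mem_dom_iff_haltsAt h2y, ← h] at hy
  have := haltsAt_unique hx hy
  exact eq_of_unpair_eq h (by omega)

section Rigidity

variable {s s' : List ℕ} {e : ℕ → ℕ}

theorem emb_path_eq (hs : TupleIn haltStr s) (hs' : TupleIn haltStr s')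
    (he : IsEmbMap (haltStr.sub s) (haltStr.sub s') e) (n : ℕ)
    (hn : ∀ k ≤ n, Nat.pair k 0 ∈ s) : e (Nat.pair n 0) = Nat.pair n 0 := by
  obtain ⟨-, hinj, hedge⟩ := (isEmbMap_sub_iff hs hs').1 he
  induction n with
  | zero =>
    have h := (hedge 0 _ (hn 0 le_rfl) _ (hn 0 le_rfl)).1 (by simp [Edge])
    simp only [Edge] at h
    refine eq_of_unpair_eq ?_ ?_ <;> rw [Nat.unpair_pair] <;> dsimp only <;> omega
  | succ n ih =>
    have ih := ih fun k hk => hn k (hk.trans n.le_succ)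
    have h := (hedge 0 _ (hn n n.le_succ) _ (hn (n + 1) le_rfl)).1 (by simp [Edge])
    rw [ih] at h
    simp only [Edge, Nat.unpair_pair] at h
    have h1 : (e (Nat.pair (n + 1) 0)).unpair.1 = n + 1 := by
      rcases h with ⟨-, -, h0, h | ⟨rfl, h⟩⟩ | h | h
      · exact h
      · have : e (Nat.pair 1 0) = e (Nat.pair 0 0) := by
          rw [ih]
          exact eq_of_unpair_eq (by simpa using h) (by simpa using h0)
        have := congrArg (fun z => z.unpair.1)
          (hinj _ (hn 1 le_rfl) _ (hn 0 (Nat.zero_le _)) this)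
        simp at this
      · omega
      · omega
    refine eq_of_unpair_eq ?_ ?_ <;> rw [Nat.unpair_pair] <;> dsimp only <;> omega

theorem emb_attached (hs : TupleIn haltStr s) (hs' : TupleIn haltStr s')
    (he : IsEmbMap (haltStr.sub s) (haltStr.sub s') e) {x : ℕ}
    (hn : ∀ k ≤ x.unpair.1, Nat.pair k 0 ∈ s) (hx : x ∈ s) (h1 : 1 ≤ x.unpair.2) :
    (e x).unpair.1 = x.unpair.1 ∧ 1 ≤ (e x).unpair.2 := by
  obtain ⟨-, -, hedge⟩ := (isEmbMap_sub_iff hs hs').1 he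
  have h := (hedge 1 _ (hn _ le_rfl) _ hx).1 (by simp [Edge, h1])
  rw [emb_path_eq hs hs' he _ hn] at h
  simp only [Edge, Nat.unpair_pair] at h
  omega

theorem emb_eq_of_two_le (hs : TupleIn haltStr s) (hs' : TupleIn haltStr s')
    (he : IsEmbMap (haltStr.sub s) (haltStr.sub s') e) {x : ℕ}
    (hn : ∀ k ≤ x.unpair.1, Nat.pair k 0 ∈ s) (ha : Nat.pair x.unpair.1 1 ∈ s) (hx : x ∈ s)
    (h2 : 2 ≤ x.unpair.2) : e x = x ∧ e (Nat.pair x.unpair.1 1) = Nat.pair x.unpair.1 1 := by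
  obtain ⟨hmap, -, hedge⟩ := (isEmbMap_sub_iff hs hs').1 he
  have h := (hedge 2 _ ha _ hx).1 (by simp [Edge, h2])
  obtain ⟨h1, -⟩ := emb_attached hs hs' he hn hx (by omega)
  simp only [Edge] at h
  exact ⟨eq_of_two_le (hs' _ (hmap x hx)) (hs x hx) (by omega) h2 h1,
    eq_of_unpair_eq (by rw [Nat.unpair_pair]; dsimp only; omega)
      (by rw [Nat.unpair_pair]; dsimp only; omega)⟩

/-- Embeddings fix every initial part of the halting structure pointwise. -/
theorem emb_eq_self {N : ℕ} (hs : ∀ x, x ∈ s ↔ x ∈ haltStr.dom ∧ x.unpair.1 ≤ N)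
    (hs' : TupleIn haltStr s') (he : IsEmbMap (haltStr.sub s) (haltStr.sub s') e) {x : ℕ}
    (hx : x ∈ s) : e x = x := by
  have hsd : TupleIn haltStr s := fun x hx => ((hs x).1 hx).1
  have hxN := ((hs x).1 hx).2
  have hlow : ∀ k ≤ x.unpair.1, ∀ m < 2, Nat.pair k m ∈ s := fun k hk m hm =>
    (hs _).2 ⟨mem_dom_of_lt_two hm, by simpa using hk.trans hxN⟩
  have hpath : ∀ k ≤ x.unpair.1, Nat.pair k 0 ∈ s := fun k hk => hlow k hk 0 (by norm_num)
  have ha := hlow _ le_rfl 1 (by norm_num)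
  obtain h0 | h1 | h2 : x.unpair.2 = 0 ∨ x.unpair.2 = 1 ∨ 2 ≤ x.unpair.2 := by omega
  · have := emb_path_eq hsd hs' he _ hpath
    rwa [← h0, Nat.pair_unpair] at this
  · obtain ⟨h3, h4⟩ := emb_attached hsd hs' he hpath hx h1.ge
    by_cases h5 : 2 ≤ (e x).unpair.2
    · have hex : e x ∈ s := (hs _).2
        ⟨hs' _ (((isEmbMap_sub_iff hsd hs').1 he).1 x hx), h3.trans_le hxN⟩
      have := (emb_eq_of_two_le hsd hs' he (h3 ▸ hpath) (h3 ▸ ha) hex h5).2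
      rwa [h3, ← h1, Nat.pair_unpair] at this
    · exact eq_of_unpair_eq h3 (by omega)
  · exact (emb_eq_of_two_le hsd hs' he hpath ha hx h2).1

end Rigidity

theorem exists_initialPart (N : ℕ) :
    ∃ s : List ℕ, ∀ x, x ∈ s ↔ x ∈ haltStr.dom ∧ x.unpair.1 ≤ N := by
  have hfin : { x | x ∈ haltStr.dom ∧ x.unpair.1 ≤ N }.Finite := by
    refine Set.Finite.of_injOn (f := fun x : ℕ => (x.unpair.1, min x.unpair.2 2))
      (t := Set.Iic N ×ˢ Set.Iic 2) (fun x hx => ⟨hx.2, min_le_right _ _⟩) ?_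
      ((Set.finite_Iic N).prod (Set.finite_Iic 2))
    intro x hx y hy hxy
    obtain ⟨h1, h2⟩ := Prod.ext_iff.1 hxy
    dsimp only at h1 h2
    by_cases h : 2 ≤ x.unpair.2
    · exact eq_of_two_le hx.1 hy.1 h (by omega) h1
    · exact eq_of_unpair_eq h1 (by omega)
  exact ⟨hfin.toFinset.toList, by simp⟩

/-! ### Cofinal amalgamation in the age of the halting structure -/

/-- Isomorphic copies of finite substructures of the halting structure. -/
def haltAge : Set (Str haltLang) := { B | ∃ s, TupleIn haltStr s ∧ Isom B (haltStr.sub s) }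

theorem haltAge_coAP : CoAP haltAge := by
  rintro A ⟨s, hs, k, hk⟩
  obtain ⟨t, ht⟩ := exists_initialPart ((s.map fun x => x.unpair.1).sum)
  have htd : TupleIn haltStr t := fun x hx => ((ht x).1 hx).1
  refine ⟨haltStr.sub t, ⟨⟨t, htd, Isom.refl _⟩, ?_⟩, _, IsEmbMap.comp (g := fun x => x)
    ((isEmbMap_sub_iff hs htd).2 ⟨fun x hx => (ht x).2 ⟨hs x hx, ?_⟩, fun _ _ _ _ h => h,
      fun _ _ _ _ _ => Iff.rfl⟩) hk.1⟩
  · rintro B₀ ⟨s₀, hs₀, k₀, hk₀⟩ B₁ ⟨s₁, hs₁, k₁, hk₁⟩ f₀ f₁ hf₀ hf₁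
    have hu : TupleIn haltStr (s₀ ++ s₁) := fun x hx =>
      (List.mem_append.1 hx).elim (hs₀ x) (hs₁ x)
    refine ⟨haltStr.sub (s₀ ++ s₁), ⟨_, hu, Isom.refl _⟩, k₀, k₁,
      IsEmbMap.comp (g := fun x => x) ((isEmbMap_sub_iff hs₀ hu).2
        ⟨fun x hx => List.mem_append_left _ hx, fun _ _ _ _ h => h, fun _ _ _ _ _ => Iff.rfl⟩)
        hk₀.1,
      IsEmbMap.comp (g := fun x => x) ((isEmbMap_sub_iff hs₁ hu).2
        ⟨fun x hx => List.mem_append_right _ hx, fun _ _ _ _ h => h, fun _ _ _ _ _ => Iff.rfl⟩)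
        hk₁.1, fun x hx => ?_⟩
    have hxt := (inClosure_haltStr.1 hx).1
    exact (emb_eq_self ht hs₀ (hk₀.1.comp hf₀) hxt).trans
      (emb_eq_self ht hs₁ (hk₁.1.comp hf₁) hxt).symm
  · exact List.le_sum_of_mem (List.mem_map_of_mem hx)

/-- The path up to `(n, 0)` together with `(n, 1)`. -/
def gadget (n : ℕ) : List ℕ := (List.range (n + 1)).map (fun k => Nat.pair k 0) ++ [Nat.pair n 1]

theorem tupleIn_gadget (n : ℕ) : TupleIn haltStr (gadget n) := by
  intro x hx
  simp only [gadget, List.mem_append, List.mem_map, List.mem_singleton] at hx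
  rcases hx with ⟨k, -, rfl⟩ | rfl <;> exact mem_dom_of_lt_two (by norm_num)

/-- An amalgamation base containing a copy of the `n`-th gadget contains every element that
enters the structure on account of `n`. -/
theorem mem_of_amalgBase {n b : ℕ} {s : List ℕ} {e : ℕ → ℕ} (hs : TupleIn haltStr s)
    (hbase : AmalgBase haltAge (haltStr.sub s))
    (he : IsEmbMap (haltStr.sub (gadget n)) (haltStr.sub s) e)
    (hb : b ∈ haltStr.dom) (hbn : b.unpair.1 = n) (hb2 : 2 ≤ b.unpair.2) : b ∈ s := by
  classical
  by_contra hbs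
  have hg := tupleIn_gadget n
  have hgpath : ∀ k ≤ n, Nat.pair k 0 ∈ gadget n := fun k hk =>
    List.mem_append_left _ (List.mem_map.2 ⟨k, List.mem_range.2 (Nat.lt_succ_of_le hk), rfl⟩)
  have hga : Nat.pair n 1 ∈ gadget n := List.mem_append_right _ (by simp)
  have hmap := ((isEmbMap_sub_iff hg hs).1 he).1
  have hpath : ∀ k ≤ n, Nat.pair k 0 ∈ s := fun k hk => by
    rw [← emb_path_eq hg hs he k fun j hj => hgpath j (hj.trans hk)]
    exact hmap _ (hgpath k hk)
  have ha : Nat.pair n 1 ∈ s := by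
    obtain ⟨h1, h2⟩ := emb_attached hg hs he (by simpa using hgpath) hga (by simp)
    simp only [Nat.unpair_pair] at h1
    have h3 := hmap _ hga
    by_cases h4 : 2 ≤ (e (Nat.pair n 1)).unpair.2
    · rw [eq_of_two_le (hs _ h3) hb h4 hb2 (h1.trans hbn.symm)] at h3
      exact absurd h3 hbs
    · rwa [eq_of_unpair_eq (x := e (Nat.pair n 1)) (y := Nat.pair n 1) (by simpa using h1)
        (by rw [Nat.unpair_pair]; dsimp only; omega)] at h3
  have hu : TupleIn haltStr (s ++ [b]) := by
    intro x hx
    rcases List.mem_append.1 hx with hx | hx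
    · exact hs x hx
    · exact List.mem_singleton.1 hx ▸ hb
  have hbu : b ∈ s ++ [b] := List.mem_append_right _ (by simp)
  let f : ℕ → ℕ := fun x => if x = Nat.pair n 1 then b else x
  have hid : IsEmbMap (haltStr.sub s) (haltStr.sub (s ++ [b])) fun x => x :=
    (isEmbMap_sub_iff hs hu).2 ⟨fun x hx => List.mem_append_left _ hx, fun _ _ _ _ h => h,
      fun _ _ _ _ _ => Iff.rfl⟩
  have hf : IsEmbMap (haltStr.sub s) (haltStr.sub (s ++ [b])) f := by
    refine (isEmbMap_sub_iff hs hu).2 ⟨fun x hx => ?_, fun x hx y hy hxy => ?_,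
      fun r x hx y hy => ?_⟩
    · simp only [f]
      split_ifs
      exacts [hbu, List.mem_append_left _ hx]
    · simp only [f] at hxy
      split_ifs at hxy with h1 h2 h2
      · rw [h1, h2]
      · exact absurd (hxy ▸ hy) hbs
      · exact absurd (hxy ▸ hx) hbs
      · exact hxy
    · have hne : ∀ z ∈ s, 2 ≤ z.unpair.2 → z.unpair.1 ≠ n := fun z hz h2 hzn =>
        hbs (eq_of_two_le hb (hs z hz) hb2 h2 (hbn.trans hzn.symm) ▸ hz)
      have hney : y ≠ Nat.pair n 1 → y.unpair.1 = n → y.unpair.2 = 0 := by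
        intro h1 h2
        by_contra h0
        by_cases h3 : 2 ≤ y.unpair.2
        · exact hne y hy h3 h2
        · exact h1 (eq_of_unpair_eq (by simpa using h2)
            (by rw [Nat.unpair_pair]; dsimp only; omega))
      have hnex : x ≠ Nat.pair n 1 → x.unpair.1 = n → x.unpair.2 ≠ 1 := fun h1 h2 h3 =>
        h1 (eq_of_unpair_eq (by simpa using h2) (by simpa using h3))
      simp only [f]
      split_ifs with h1 h2 h2
      · subst h1 h2
        simp only [Edge, Nat.unpair_pair]
        omega
      · subst h1
        have := hney h2
        simp only [Edge, Nat.unpair_pair]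
        omega
      · subst h2
        have := hnex h1
        simp only [Edge, Nat.unpair_pair]
        omega
      · rfl
  have hmem : haltStr.sub (s ++ [b]) ∈ haltAge := ⟨_, hu, Isom.refl _⟩
  obtain ⟨D, ⟨t, ht, k, hk⟩, g₀, g₁, hg₀, hg₁, hcomm⟩ :=
    hbase.2 _ hmem _ hmem _ _ hid hf
  have hpu : ∀ k ≤ b.unpair.1, Nat.pair k 0 ∈ s ++ [b] := fun k hk =>
    List.mem_append_left _ (hpath k (hbn ▸ hk))
  have hau : Nat.pair b.unpair.1 1 ∈ s ++ [b] := hbn.symm ▸ List.mem_append_left _ ha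
  have e₀ := (emb_eq_of_two_le hu ht (hk.1.comp hg₀) hpu hau hbu hb2).2
  have e₁ := (emb_eq_of_two_le hu ht (hk.1.comp hg₁) hpu hau hbu hb2).1
  have hc := hcomm (Nat.pair n 1) (inClosure_haltStr.2 ⟨ha, hs _ ha⟩)
  simp only [f, if_true] at hc
  rw [hbn, hc, e₁] at e₀
  rw [e₀, Nat.unpair_pair] at hb2
  simp at hb2

/-! ### The computable age of the halting structure -/

theorem primrec_ofNat_list : Primrec fun n : ℕ => ofNat (List ℕ) n := Primrec.ofNat (List ℕ)

theorem primrec_inHaltDom : Primrec inHaltDom := by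
  have hm : Primrec fun x : ℕ => x.unpair.2 := Primrec.snd.comp Primrec.unpair
  exact Primrec.or.comp (Primrec.nat_lt.comp hm (Primrec.const 2)).decide
    (primrec_haltsAt.comp (Primrec.fst.comp Primrec.unpair)
      (Primrec.nat_sub.comp hm (Primrec.const 2)))

theorem primrecPred_mem_dom : PrimrecPred fun x => x ∈ haltStr.dom :=
  Primrec.eq.comp primrec_inHaltDom (Primrec.const true)

theorem primrecRel_haltStr_rel : PrimrecRel haltStr.rel := by
  have hx : Primrec fun p : ℕ × List ℕ => p.2.getD 0 0 :=
    (Primrec.list_getD 0).comp Primrec.snd (Primrec.const 0)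
  have hy : Primrec fun p : ℕ × List ℕ => p.2.getD 1 0 :=
    (Primrec.list_getD 0).comp Primrec.snd (Primrec.const 1)
  have hx1 := Primrec.fst.comp (Primrec.unpair.comp hx)
  have hx2 := Primrec.snd.comp (Primrec.unpair.comp hx)
  have hy1 := Primrec.fst.comp (Primrec.unpair.comp hy)
  have hy2 := Primrec.snd.comp (Primrec.unpair.comp hy)
  have eqc : ∀ {f : ℕ × List ℕ → ℕ} (_ : Primrec f) (k : ℕ), PrimrecPred fun p => f p = k :=
    fun hf k => Primrec.eq.comp hf (Primrec.const k)
  have lec : ∀ {f : ℕ × List ℕ → ℕ} (_ : Primrec f) (k : ℕ), PrimrecPred fun p => k ≤ f p :=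
    fun hf k => Primrec.nat_le.comp (Primrec.const k) hf
  have hr : Primrec fun p : ℕ × List ℕ => p.1 := Primrec.fst
  have heq := Primrec.eq.comp hx1 hy1
  exact (primrecPred_mem_dom.forall_mem_list.comp Primrec.snd).and <|
    (eqc (Primrec.list_length.comp Primrec.snd) 2).and <|
    ((eqc hr 0).and <| (eqc hx2 0).and <| (eqc hy2 0).and <|
      (Primrec.eq.comp hy1 (Primrec.succ.comp hx1)).or ((eqc hx1 0).and (eqc hy1 0))).or <|
    ((eqc hr 1).and <| (eqc hx2 0).and <| (lec hy2 1).and heq).or <|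
    (eqc hr 2).and <| (eqc hx2 1).and <| (lec hy2 2).and heq

theorem primrecRel_mem_list : PrimrecRel fun (x : ℕ) (s : List ℕ) => x ∈ s :=
  (((Primrec.eq (α := ℕ)).exists_mem_list).comp Primrec.snd Primrec.fst).of_eq fun p => by simp

theorem primrecRel_subset_list : PrimrecRel fun (as s : List ℕ) => ∀ x ∈ as, x ∈ s :=
  primrecRel_mem_list.forall_mem_list

/-- The finite tuple of the halting structure with index `i`. -/
def haltTup (i : ℕ) : List ℕ := (ofNat (List ℕ) i.unpair.1).filter inHaltDom

theorem tupleIn_haltTup (i : ℕ) : TupleIn haltStr (haltTup i) := fun _ hx =>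
  (List.mem_filter.1 hx).2

theorem haltTup_pair {s : List ℕ} (hs : TupleIn haltStr s) (n : ℕ) :
    haltTup (Nat.pair (Encodable.encode s) n) = s := by
  rw [haltTup, Nat.unpair_pair, Denumerable.ofNat_encode]
  exact List.filter_eq_self.2 hs

theorem primrec_haltTup : Primrec haltTup := by
  have : PrimrecRel fun (x : ℕ) (_ : Unit) => inHaltDom x = true :=
    primrecPred_mem_dom.comp Primrec.fst
  exact (this.listFilter.comp (primrec_ofNat_list.comp (Primrec.fst.comp Primrec.unpair))
    (Primrec.const ())).of_eq fun i => by simp [haltTup]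

theorem mem_sub_dom {s : List ℕ} (hs : TupleIn haltStr s) {x : ℕ} :
    x ∈ (haltStr.sub s).dom ↔ x ∈ s :=
  inClosure_haltStr.trans ⟨fun h => h.1, fun h => ⟨h, hs x h⟩⟩

theorem sub_rel_iff {s : List ℕ} (hs : TupleIn haltStr s) {r : ℕ} {as : List ℕ} :
    (haltStr.sub s).rel r as ↔ haltStr.rel r as ∧ ∀ x ∈ as, x ∈ s :=
  and_congr_right fun _ => forall₂_congr fun _ _ => mem_sub_dom hs

/-- The canonical age of the halting structure. -/
def haltCompAge : CompAge haltLang where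
  tup := haltTup
  str i := haltStr.sub (haltTup i)
  tup_mem i _ hx := (mem_sub_dom (tupleIn_haltTup i)).2 hx
  gen i x := by
    refine ⟨fun hx => .base ((mem_sub_dom (tupleIn_haltTup i)).1 hx) hx, fun h => h.mem_dom⟩

theorem haltCompAge_cls : haltCompAge.cls = haltAge := by
  ext B
  constructor
  · rintro ⟨i, hi⟩
    exact ⟨_, tupleIn_haltTup i, hi⟩
  · rintro ⟨s, hs, h⟩
    refine ⟨Nat.pair (Encodable.encode s) 0, ?_⟩
    change Isom B (haltStr.sub (haltTup _))
    rwa [haltTup_pair hs]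

theorem setRecIn_of_primrecPred {A : Set ℕ} {p : ℕ → Prop} (hp : PrimrecPred p)
    (h : ∀ n, n ∈ A ↔ p n) (O : Set ℕ) : SetRecIn O A := by
  classical
  exact setRecIn_of_computable hp.decide.to_comp (by simpa using h) O

theorem ceIn_of_primrecPred {A : Set ℕ} {p : ℕ → Prop} (hp : PrimrecPred p)
    (h : ∀ n, n ∈ A ↔ p n) (O : Set ℕ) : CEIn O A := by
  classical
  exact ceIn_of_computable hp.decide.to_comp (by simpa using h) O

theorem haltLang_computableRep : haltLang.ComputableRep :=
  ⟨totalComputableIn_of_computable (Primrec.encode.comp <| Primrec.ite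
      (Primrec.nat_lt.comp Primrec.id (Primrec.const 3)) (Primrec.const _)
      (Primrec.const _)).to_comp _,
    totalComputableIn_of_computable (Computable.const _) _⟩

theorem haltLang_finiteRelational : haltLang.FiniteRelational := by
  refine ⟨fun _ => rfl, (Set.finite_Iio 3).subset fun r hr => ?_⟩
  by_contra h
  have h : ¬ r < 3 := h
  simp [haltLang, h] at hr

theorem strComputableIn_of_primrec {A : Str haltLang} (hd : PrimrecPred fun x => x ∈ A.dom)
    (hr : PrimrecRel A.rel) (O : Set ℕ) : StrComputableIn O A := by
  refine ⟨setRecIn_of_primrecPred hd (fun _ => Iff.rfl) O, setRecIn_of_primrecPred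
    (hr.comp (Primrec.fst.comp Primrec.unpair)
      (primrec_ofNat_list.comp (Primrec.snd.comp Primrec.unpair))) (fun p => ?_) O,
    setRecIn_of_computable (Computable.const false) (fun p => ?_) O⟩
  · constructor
    · rintro ⟨r, as, -, h, rfl⟩
      simpa using h
    · exact fun h => ⟨_, _, (A.rel_valid _ _ h).2, h, by simp⟩
  · simp [haltLang]

theorem haltStr_computable (O : Set ℕ) : StrComputableIn O haltStr :=
  strComputableIn_of_primrec primrecPred_mem_dom primrecRel_haltStr_rel O

theorem haltCompAge_computable (O : Set ℕ) : AgeComputableIn O haltCompAge := by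
  constructor
  · have hq : Primrec fun p : ℕ => p.unpair.1 := Primrec.fst.comp Primrec.unpair
    have hq2 : Primrec fun p : ℕ => p.unpair.2 := Primrec.snd.comp Primrec.unpair
    have ht : Primrec fun p : ℕ => haltTup p.unpair.2.unpair.1 :=
      primrec_haltTup.comp (hq.comp hq2)
    have hz : Primrec fun p : ℕ => p.unpair.2.unpair.2 := hq2.comp hq2
    have hr : Primrec fun p : ℕ => p.unpair.2.unpair.2.unpair.1 := hq.comp hz
    have has : Primrec fun p : ℕ => ofNat (List ℕ) p.unpair.2.unpair.2.unpair.2 :=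
      primrec_ofNat_list.comp (hq2.comp hz)
    have hsub := primrecRel_subset_list.comp has ht
    have hrel := primrecRel_haltStr_rel.comp hr has
    have eqc : ∀ k : ℕ, PrimrecPred fun p : ℕ => p.unpair.1 = k :=
      fun k => Primrec.eq.comp hq (Primrec.const k)
    refine ceIn_of_primrecPred
      (((eqc 0).and (Primrec.eq.comp hz (Primrec.encode.comp ht))).or <|
        ((eqc 1).and (primrecRel_mem_list.comp hz ht)).or <|
        ((eqc 2).and (hsub.and hrel)).or <|
        (eqc 3).and <| hsub.and <| (Primrec.nat_lt.comp hr (Primrec.const 3)).and <|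
          (Primrec.eq.comp (Primrec.list_length.comp has) (Primrec.const 2)).and hrel.not)
      (fun p => ?_) O
    constructor
    · rintro ((((⟨i, rfl⟩ | ⟨i, x, hx, rfl⟩) | ⟨i, r, as, ha, h, rfl⟩) |
        ⟨i, r, as, ha, hl, h, rfl⟩) | ⟨i, f, as, b, -, hf, -⟩)
      · left
        simp [haltCompAge]
      · right; left
        simpa using (mem_sub_dom (tupleIn_haltTup i)).1 hx
      · right; right; left
        simpa using ((sub_rel_iff (tupleIn_haltTup i)).1 h).symm
      · right; right; right
        have ha : ∀ x ∈ as, x ∈ haltTup i := fun x hx =>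
          (mem_sub_dom (tupleIn_haltTup i)).1 (ha x hx)
        have h : ¬ haltStr.rel r as := fun h' => h ((sub_rel_iff (tupleIn_haltTup i)).2 ⟨h', ha⟩)
        have hr : r < 3 := by
          by_contra hr
          simp [haltLang, hr] at hl
        have hl : as.length = 2 := by simpa [haltLang, hr, eq_comm] using hl
        simpa [hl, hr, h] using ha
      · simp [haltLang] at hf
    · have hi := tupleIn_haltTup p.unpair.2.unpair.1
      rintro (⟨h0, h⟩ | ⟨h0, h⟩ | ⟨h0, ha, h⟩ | ⟨h0, ha, hr, hl, h⟩)
      · refine .inl (.inl (.inl (.inl ⟨p.unpair.2.unpair.1, ?_⟩)))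
        change p = Nat.pair 0 (Nat.pair _ (Encodable.encode (haltTup _)))
        rw [← h, ← h0, Nat.pair_unpair, Nat.pair_unpair]
      · refine .inl (.inl (.inl (.inr ⟨_, _, (mem_sub_dom hi).2 h, ?_⟩)))
        rw [← h0, Nat.pair_unpair, Nat.pair_unpair]
      · refine .inl (.inl (.inr ⟨_, _, _, fun x hx => (mem_sub_dom hi).2 (ha x hx),
          (sub_rel_iff hi).2 ⟨h, ha⟩, ?_⟩))
        rw [← h0, Denumerable.encode_ofNat, Nat.pair_unpair, Nat.pair_unpair, Nat.pair_unpair]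
      · refine .inl (.inr ⟨_, _, _, fun x hx => (mem_sub_dom hi).2 (ha x hx),
          by simp [haltLang, hr, hl], fun h' => h ((sub_rel_iff hi).1 h').1, ?_⟩)
        rw [← h0, Denumerable.encode_ofNat, Nat.pair_unpair, Nat.pair_unpair, Nat.pair_unpair]
  · intro i
    have hi := tupleIn_haltTup i
    exact strComputableIn_of_primrec
      ((primrecRel_mem_list.comp Primrec.id (Primrec.const (haltTup i))).of_eq
        fun x => (mem_sub_dom hi).symm)
      ((primrecRel_haltStr_rel.and (primrecRel_subset_list.comp Primrec.snd
        (Primrec.const (haltTup i)))).of_eq fun p => (sub_rel_iff hi).symm) O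

theorem isCanonicalAgeOf_haltCompAge (O : Set ℕ) : IsCanonicalAgeOf O haltCompAge haltStr :=
  ⟨totalComputableIn_of_computable (Primrec.encode.comp primrec_haltTup).to_comp O,
    tupleIn_haltTup,
    fun _ hs n => ⟨_, Nat.right_le_pair _ n, haltTup_pair hs n⟩, fun _ => rfl⟩

/-! ### The lower bound -/

theorem primrec_gadget : Primrec gadget :=
  Primrec.list_append.comp
    (Primrec.list_map (Primrec.list_range.comp Primrec.succ)
      (Primrec₂.natPair.comp Primrec.snd (Primrec.const 0)))
    (Primrec.list_cons.comp (Primrec₂.natPair.comp Primrec.id (Primrec.const 1))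
      (Primrec.const []))

theorem isEmbMap_of_isEmb {F : PotEmb} (hF : F.IsEmb haltCompAge) :
    ∃ e, IsEmbMap (haltStr.sub (haltTup F.i)) (haltStr.sub (haltTup F.j)) e := by
  obtain ⟨e, -, ⟨h1, h2, h3, -⟩, -⟩ := hF
  have hdom : ∀ x, x ∈ (haltStr.sub (haltTup F.i)).dom →
      x ∈ ((haltCompAge.str F.i).sub (haltTup F.i)).dom := fun x hx =>
    (haltCompAge.gen F.i x).1 hx
  refine ⟨e, fun x hx => InClosure.mem_dom (h1 x (hdom x hx)),
    fun x hx y hy => h2 x (hdom x hx) y (hdom y hy), fun r as ha => ?_,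
    fun f as hf => by simp [haltLang] at hf⟩
  have ha' := fun x hx => hdom x (ha x hx)
  have := h3 r as ha'
  constructor
  · exact fun h => (this.1 ⟨h, ha'⟩).1
  · refine fun h => (this.2 ⟨h, fun y hy => ?_⟩).1
    obtain ⟨x, hx, rfl⟩ := List.mem_map.1 hy
    exact h1 x (ha' x hx)

theorem zeroJump_le_of_ccoAP {s : Set ℕ} (h : CcoAP s haltCompAge) : TuringLE zeroJump s := by
  obtain ⟨W, ⟨hW, -, -, hcov⟩, hce, -⟩ := h
  let R : ℕ → ℕ → Prop := fun n p => p.unpair.1 = Nat.pair (Encodable.encode (gadget n)) 0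
  let φ : ℕ → ℕ → Prop := fun n p =>
    ∃ x ∈ haltTup p.unpair.2.unpair.1, x.unpair.1 = n ∧ 2 ≤ x.unpair.2
  have hR : PrimrecRel R := Primrec.eq.comp
    (Primrec.fst.comp (Primrec.unpair.comp Primrec.snd))
    (Primrec₂.natPair.comp (Primrec.encode.comp (primrec_gadget.comp Primrec.fst))
      (Primrec.const 0))
  have hwit : PrimrecRel fun x n : ℕ => x.unpair.1 = n ∧ 2 ≤ x.unpair.2 :=
    (Primrec.eq.comp (Primrec.fst.comp (Primrec.unpair.comp Primrec.fst)) Primrec.snd).and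
      (Primrec.nat_le.comp (Primrec.const 2)
        (Primrec.snd.comp (Primrec.unpair.comp Primrec.fst)))
  have hφ : PrimrecRel φ := hwit.exists_mem_list.comp
    (primrec_haltTup.comp (Primrec.fst.comp (Primrec.unpair.comp
      (Primrec.snd.comp (Primrec.unpair.comp Primrec.snd))))) Primrec.fst
  classical
  refine setRecIn_of_ceIn_witness hce hR.decide.to_comp hφ.decide.to_comp (fun n => ?_) ?_
  · obtain ⟨F, hF, hi⟩ := hcov (Nat.pair (Encodable.encode (gadget n)) 0)
    exact ⟨F.code, ⟨F, hF, rfl⟩, by simp [R, PotEmb.code, hi]⟩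
  · rintro n _ ⟨F, hF, rfl⟩ hi
    obtain ⟨-, hemb, hbase⟩ := hW F hF
    have hi : F.i = Nat.pair (Encodable.encode (gadget n)) 0 := by
      simpa [R, PotEmb.code] using hi
    obtain ⟨e, he⟩ := isEmbMap_of_isEmb hemb
    rw [hi, haltTup_pair (tupleIn_gadget n)] at he
    rw [haltCompAge_cls] at hbase
    have hj : F.code.unpair.2.unpair.1 = F.j := by simp [PotEmb.code]
    rw [mem_zeroJump_iff_haltsAt, decide_eq_true_iff]
    simp only [φ, hj]
    constructor
    · rintro ⟨t, ht⟩
      refine ⟨Nat.pair n (t + 2), mem_of_amalgBase (tupleIn_haltTup F.j) hbase he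
        ((mem_dom_iff_haltsAt (by simp)).2 (by simpa using ht)) (by simp) (by simp),
        by simp, by simp⟩
    · rintro ⟨x, hx, rfl, h2⟩
      exact ⟨_, (mem_dom_iff_haltsAt h2).1 (tupleIn_haltTup F.j x hx)⟩

/-- There is a computable age `𝕂`, the canonical computable age of a
computable structure in a finite relational language, which has coAP but such that
`CcoAP(s)` implies `0' ≤_T s`. -/
theorem lower_bound_coAP_finite_language :
    ∃ L : Lang, L.ComputableRep ∧ L.FiniteRelational ∧
    ∃ M : Str L, StrComputableIn ∅ M ∧
    ∃ K : CompAge L, AgeComputableIn ∅ K ∧ IsCanonicalAgeOf ∅ K M ∧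
      CoAP K.cls ∧
      ∀ s : Set ℕ, CcoAP s K → TuringLE zeroJump s :=
  ⟨haltLang, haltLang_computableRep, haltLang_finiteRelational, haltStr, haltStr_computable ∅,
    haltCompAge, haltCompAge_computable ∅, isCanonicalAgeOf_haltCompAge ∅,
    haltCompAge_cls ▸ haltAge_coAP, fun _ => zeroJump_le_of_ccoAP⟩

end CFL
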